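/- arXiv:0905.3697 — 3 statements merged into one kernel-verified Lean document; each statement's English description precedes it below -/
import Mathlib

section
/- There exist positive integers n and d, weights w_1,…,w_d ≥ 0 with ∑_{i=1}^d w_i = 1, and unitary n×n complex matrices U_1,…,U_d, such that the random unitary channel Φ and its complex conjugate channel Φ̄ satisfy S_min(Φ ⊗ Φ̄) < S_min(Φ) + S_min(Φ̄); that is, additivity of minimal output von Neumann entropy fails for the product channel Φ ⊗ Φ̄. -/
open scoped BigOperators ComplexOrder
open Matrix

/-- Von Neumann entropy of a (Hermitian) matrix, via its eigenvalues;
`Real.log 0 = 0` gives the convention `0 · log 0 = 0`. -/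
noncomputable def vnEntropy {m : Type*} [Fintype m] [DecidableEq m] (ρ : Matrix m m ℂ) : ℝ :=
  if h : ρ.IsHermitian then -∑ i, h.eigenvalues i * Real.log (h.eigenvalues i) else 0

/-- Minimal output entropy of a channel: infimum of output entropies over density matrices. -/
noncomputable def minOutEntropy {m k : Type*} [Fintype m] [DecidableEq m] [Fintype k]
    [DecidableEq k] (Ψ : Matrix m m ℂ → Matrix k k ℂ) : ℝ :=
  sInf {x : ℝ | ∃ ρ : Matrix m m ℂ, ρ.PosSemidef ∧ ρ.trace = 1 ∧ x = vnEntropy (Ψ ρ)}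

/-- The random unitary channel `ρ ↦ ∑ i, w i • U i ρ (U i)ᴴ`. -/
noncomputable def ruChannel {n d : ℕ} (w : Fin d → ℝ) (U : Fin d → Matrix (Fin n) (Fin n) ℂ)
    (ρ : Matrix (Fin n) (Fin n) ℂ) : Matrix (Fin n) (Fin n) ℂ :=
  ∑ i, (w i : ℂ) • (U i * ρ * (U i)ᴴ)

/-- The complex conjugate channel `ρ ↦ ∑ i, w i • conj (U i) ρ (U i)ᵀ`. -/
noncomputable def conjRuChannel {n d : ℕ} (w : Fin d → ℝ) (U : Fin d → Matrix (Fin n) (Fin n) ℂ)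
    (ρ : Matrix (Fin n) (Fin n) ℂ) : Matrix (Fin n) (Fin n) ℂ :=
  ∑ i, (w i : ℂ) • ((U i).map star * ρ * (U i)ᵀ)

open Kronecker in
/-- The product channel `Φ ⊗ Φ̄` acting on `n² × n²` matrices via Kronecker products. -/
noncomputable def prodChannel {n d : ℕ} (w : Fin d → ℝ) (U : Fin d → Matrix (Fin n) (Fin n) ℂ)
    (ρ : Matrix (Fin n × Fin n) (Fin n × Fin n) ℂ) :
    Matrix (Fin n × Fin n) (Fin n × Fin n) ℂ :=
  ∑ i, ∑ j, ((w i * w j : ℝ) : ℂ) •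
    ((U i ⊗ₖ (U j).map star) * ρ * (U i ⊗ₖ (U j).map star)ᴴ)

namespace RandomUnitary

/-- Hoeffding's bound for Rademacher sums. -/
theorem sum_sign_exp_le {n : ℕ} (x : Fin n → ℝ) :
    ∑ ε : Fin n → Bool, Real.exp (∑ k, (if ε k then 1 else -1) * x k) ≤
      2 ^ n * Real.exp ((∑ k, x k ^ 2) / 2) := by
  have h : ∑ ε : Fin n → Bool, Real.exp (∑ k, (if ε k then 1 else -1) * x k) =
      ∏ k, (2 * Real.cosh (x k)) := by
    have := Finset.prod_univ_sum (fun _ : Fin n => (Finset.univ : Finset Bool))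
      (fun k b => Real.exp ((if b then 1 else -1) * x k))
    simp only [Fintype.piFinset_univ] at this
    simp only [Real.exp_sum]
    rw [← this]
    refine Finset.prod_congr rfl fun k _ => ?_
    simp [Real.cosh_eq]
    ring
  rw [h, Finset.prod_mul_distrib, Finset.prod_const, Finset.card_univ, Fintype.card_fin,
    Finset.sum_div, Real.exp_sum]
  gcongr with k
  exact Real.cosh_le_exp_half_sq _

section Haar

variable {E : Type*} [NormedAddCommGroup E] [InnerProductSpace ℂ E] [FiniteDimensional ℂ E]

theorem exists_linearIsometryEquiv_apply_eq {x y : E} (hx : ‖x‖ = 1) (hy : ‖y‖ = 1) :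
    ∃ W : E ≃ₗᵢ[ℂ] E, W x = y := by
  have hx0 : x ≠ 0 := by rintro rfl; simp at hx
  let e := LinearEquiv.toSpanNonzeroSingleton ℂ E x hx0
  let L : (ℂ ∙ x) →ₗᵢ[ℂ] E :=
    { toLinearMap := (LinearMap.toSpanSingleton ℂ E y) ∘ₗ e.symm.toLinearMap
      norm_map' := fun z => by
        obtain ⟨c, rfl⟩ := e.surjective z
        rw [LinearMap.comp_apply, LinearEquiv.coe_coe, e.symm_apply_apply]
        simp [e, norm_smul, hx, hy] }
  refine ⟨L.extend.toLinearIsometryEquiv rfl, ?_⟩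
  have h1 := L.extend_apply (e 1)
  have h2 : ((e 1 : (ℂ ∙ x)) : E) = x := by simp [e]
  rw [h2] at h1
  rw [LinearIsometry.coe_toLinearIsometryEquiv, h1]
  simp [L]

instance compactSpace_unitary : CompactSpace (unitary (E →L[ℂ] E)) := by
  have : ProperSpace (E →L[ℂ] E) := FiniteDimensional.proper ℂ _
  refine isCompact_iff_compactSpace.1 (Metric.isCompact_of_isClosed_isBounded isClosed_unitary ?_)
  refine (Metric.isBounded_iff_subset_closedBall 0).2 ⟨1, fun U hU => ?_⟩
  rw [mem_closedBall_zero_iff]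
  refine ContinuousLinearMap.opNorm_le_bound _ zero_le_one fun x => ?_
  rw [one_mul]
  exact ((Unitary.linearIsometryEquiv ⟨U, hU⟩).norm_map x).le

open MeasureTheory in
/-- Averaging over the Haar measure of the unitary group: sub-Gaussian exponential moments of the
linear functionals of the random vectors `U ψ` can be matched by a single unitary. -/
theorem exists_unitary_sum_exp_le {ι : Type*} [Fintype ι] (hE : 0 < Module.finrank ℂ E)
    (c : ι → ℝ) (hc : ∀ k, 0 ≤ c k) (u ψ : ι → E) (hψ : ∀ k, ‖ψ k‖ = 1) :
    ∃ U : E ≃ₗᵢ[ℂ] E, ∑ k, c k * Real.exp (inner ℂ (u k) (U (ψ k))).re ≤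
      ∑ k, c k * Real.exp (‖u k‖ ^ 2 / (2 * Module.finrank ℂ E)) := by
  let : MeasurableSpace (unitary (E →L[ℂ] E)) := borel _
  have : BorelSpace (unitary (E →L[ℂ] E)) := ⟨rfl⟩
  let μ : Measure (unitary (E →L[ℂ] E)) := Measure.haarMeasure ⊤
  have : IsProbabilityMeasure μ := ⟨Measure.haarMeasure_self⟩
  let act : unitary (E →L[ℂ] E) → E → E := fun V x => Unitary.linearIsometryEquiv V x
  have hcont (a b : E) : Continuous fun V : unitary (E →L[ℂ] E) =>
      Real.exp (inner ℂ (act V a) b).re := by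
    have : Continuous fun V : unitary (E →L[ℂ] E) => act V a := by
      change Continuous fun V : unitary (E →L[ℂ] E) => (V : E →L[ℂ] E) a
      fun_prop
    fun_prop
  have hexp (a b : E) : Integrable (fun V => Real.exp (inner ℂ (act V a) b).re) μ :=
    (hcont a b).integrable_of_hasCompactSupport (HasCompactSupport.of_compactSpace _)
  set n := Module.finrank ℂ E with hn
  let B := stdOrthonormalBasis ℂ E
  have hn0 : (0 : ℝ) < n := by exact_mod_cast hE
  have hsq : (0 : ℝ) < Real.sqrt n := Real.sqrt_pos.2 hn0
  let φ : (Fin n → Bool) → E := fun ε =>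
    ∑ k, (((if ε k then 1 else -1) * (Real.sqrt n)⁻¹ : ℝ) : ℂ) • B k
  have hφ (ε) : ‖φ ε‖ = 1 := by
    have : ‖φ ε‖ ^ 2 = 1 := by
      rw [← B.sum_sq_norm_inner_right]
      have (k : Fin n) : ‖inner ℂ (B k) (φ ε)‖ ^ 2 = (n : ℝ)⁻¹ := by
        rw [B.orthonormal.inner_right_fintype, Complex.norm_real, Real.norm_eq_abs, sq_abs,
          mul_pow, inv_pow, Real.sq_sqrt hn0.le]
        split_ifs <;> simp
      simp [this, hn0.ne', ← hn]
    nlinarith [norm_nonneg (φ ε)]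
  have hmean (a b : E) (hb : ‖b‖ = 1) :
      ∫ V, Real.exp (inner ℂ (act V a) b).re ∂μ ≤ Real.exp (‖a‖ ^ 2 / (2 * n)) := by
    have hinv (ε) : ∫ V, Real.exp (inner ℂ (act V a) (φ ε)).re ∂μ =
        ∫ V, Real.exp (inner ℂ (act V a) b).re ∂μ := by
      obtain ⟨W, hW⟩ := exists_linearIsometryEquiv_apply_eq hb (hφ ε)
      rw [← integral_mul_left_eq_self _ (Unitary.linearIsometryEquiv.symm W)]
      refine integral_congr_ae (Filter.Eventually.of_forall fun V => ?_)
      change Real.exp (inner ℂ (Unitary.linearIsometryEquiv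
        (Unitary.linearIsometryEquiv.symm W * V) a) (φ ε)).re = _
      rw [map_mul, MulEquiv.apply_symm_apply, LinearIsometryEquiv.mul_def,
        LinearIsometryEquiv.trans_apply, ← hW, LinearIsometryEquiv.inner_map_map]
    have hpt (V) : ∑ ε, Real.exp (inner ℂ (act V a) (φ ε)).re ≤
        2 ^ n * Real.exp (‖a‖ ^ 2 / (2 * n)) := by
      have h1 (ε) : (inner ℂ (act V a) (φ ε)).re =
          ∑ k, (if ε k then 1 else -1) * ((Real.sqrt n)⁻¹ * (inner ℂ (act V a) (B k)).re) := by
        simp only [φ, inner_sum, inner_smul_right, Complex.re_sum, Complex.re_ofReal_mul, mul_assoc]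
      simp only [h1]
      refine (sum_sign_exp_le _).trans
        (mul_le_mul_of_nonneg_left (Real.exp_le_exp.2 ?_) (by positivity))
      have h2 : ‖a‖ ^ 2 = ∑ k, ‖inner ℂ (act V a) (B k)‖ ^ 2 := by
        rw [B.sum_sq_norm_inner_left]
        simp [act]
      have h3 : ∑ k, ((Real.sqrt n)⁻¹ * (inner ℂ (act V a) (B k)).re) ^ 2 ≤ ‖a‖ ^ 2 / n := by
        rw [h2, Finset.sum_div]
        refine Finset.sum_le_sum fun k _ => ?_
        rw [mul_pow, inv_pow, Real.sq_sqrt hn0.le, div_eq_inv_mul]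
        refine mul_le_mul_of_nonneg_left ?_ (by positivity)
        exact sq_le_sq.2 ((Complex.abs_re_le_norm _).trans (le_abs_self _))
      calc _ ≤ ‖a‖ ^ 2 / n / 2 := by gcongr
        _ = _ := by field_simp
    have h4 : (2 : ℝ) ^ n * ∫ V, Real.exp (inner ℂ (act V a) b).re ∂μ ≤
        2 ^ n * Real.exp (‖a‖ ^ 2 / (2 * n)) := by
      calc _ = ∑ ε : Fin n → Bool, ∫ V, Real.exp (inner ℂ (act V a) (φ ε)).re ∂μ := by
            simp [hinv]
        _ = ∫ V, ∑ ε, Real.exp (inner ℂ (act V a) (φ ε)).re ∂μ :=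
            (integral_finsetSum _ fun ε _ => hexp a (φ ε)).symm
        _ ≤ ∫ V, 2 ^ n * Real.exp (‖a‖ ^ 2 / (2 * n)) ∂μ :=
            integral_mono (integrable_finsetSum _ fun ε _ => hexp a (φ ε)) (integrable_const _) hpt
        _ = _ := by simp
    exact le_of_mul_le_mul_left h4 (by positivity)
  have hI : Integrable (fun V => ∑ k, c k * Real.exp (inner ℂ (act V (u k)) (ψ k)).re) μ :=
    integrable_finsetSum _ fun k _ => (hexp _ _).const_mul _
  obtain ⟨V, hV⟩ := exists_le_integral hI
  refine ⟨(Unitary.linearIsometryEquiv V).symm, ?_⟩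
  calc _ = ∑ k, c k * Real.exp (inner ℂ (act V (u k)) (ψ k)).re := by
        refine Finset.sum_congr rfl fun k _ => ?_
        congr 3
        rw [← LinearIsometryEquiv.inner_map_map (Unitary.linearIsometryEquiv V)]
        simp [act]
    _ ≤ _ := hV
    _ = ∑ k, c k * ∫ V, Real.exp (inner ℂ (act V (u k)) (ψ k)).re ∂μ := by
        rw [integral_finsetSum _ fun k _ => (hexp _ _).const_mul _]
        simp [integral_const_mul]
    _ ≤ _ := Finset.sum_le_sum fun k _ =>
        mul_le_mul_of_nonneg_left (hmean _ _ (hψ k)) (hc k)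

end Haar

section Chaos

variable {E : Type*} [NormedAddCommGroup E] [InnerProductSpace ℂ E]

/-- The off-diagonal quadratic form `∑_{i < j < d} Re (a i j ⟪v i, v j⟫)`. -/
noncomputable def chaos (d : ℕ) (a : ℕ → ℕ → ℂ) (v : ℕ → E) : ℝ :=
  ∑ j ∈ Finset.range d, ∑ i ∈ Finset.range j, (a i j * inner ℂ (v i) (v j)).re

/-- The squared Frobenius norm of the strictly upper triangular part of `a`. -/
noncomputable def upperNormSq (d : ℕ) (a : ℕ → ℕ → ℂ) : ℝ :=
  ∑ j ∈ Finset.range d, ∑ i ∈ Finset.range j, ‖a i j‖ ^ 2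

theorem chaos_congr {d : ℕ} {a : ℕ → ℕ → ℂ} {v w : ℕ → E} (h : ∀ i < d, v i = w i) :
    chaos d a v = chaos d a w := by
  refine Finset.sum_congr rfl fun j hj => Finset.sum_congr rfl fun i hi => ?_
  rw [Finset.mem_range] at hi hj
  rw [h j hj, h i (hi.trans hj)]

theorem norm_sq_sum_smul (d : ℕ) (b : ℕ → ℂ) (v : ℕ → E) :
    ‖∑ i ∈ Finset.range d, star (b i) • v i‖ ^ 2 =
      ∑ i ∈ Finset.range d, ‖b i‖ ^ 2 * ‖v i‖ ^ 2 +
        2 * chaos d (fun i j => b i * star (b j)) v := by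
  induction d with
  | zero => simp [chaos]
  | succ d ih =>
    rw [Finset.sum_range_succ, @norm_add_sq ℂ, ih, chaos, chaos, Finset.sum_range_succ,
      Finset.sum_range_succ, norm_smul, sum_inner]
    simp only [inner_smul_left, inner_smul_right, map_sum, RCLike.re_eq_complex_re, mul_pow,
      RCLike.star_def, RCLike.norm_conj, Complex.conj_conj, mul_assoc]
    ring_nf

theorem sum_range_sum_range_mul_le (d : ℕ) (x : ℕ → ℝ) (hx : ∀ i, 0 ≤ x i) :
    ∑ j ∈ Finset.range d, ∑ i ∈ Finset.range j, x i * x j ≤ (∑ i ∈ Finset.range d, x i) ^ 2 / 2 := by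
  induction d with
  | zero => simp
  | succ d ih =>
    rw [Finset.sum_range_succ, Finset.sum_range_succ, ← Finset.sum_mul]
    nlinarith [hx d]

/-- Integrating out the last vector does not increase the exponent bound. -/
theorem upperNormSq_add_mul_le (d : ℕ) (a : ℕ → ℕ → ℂ) (b : ℕ → ℂ)
    (h : upperNormSq d a + ∑ i ∈ Finset.range d, ‖b i‖ ^ 2 ≤ 1 / 64) :
    upperNormSq d (fun i j => a i j + b i * star (b j)) +
      (∑ i ∈ Finset.range d, ‖b i‖ ^ 2) / 2 ≤
      upperNormSq d a + ∑ i ∈ Finset.range d, ‖b i‖ ^ 2 := by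
  set y := ∑ i ∈ Finset.range d, ‖b i‖ ^ 2 with hy
  have hy0 : 0 ≤ y := Finset.sum_nonneg fun i _ => sq_nonneg _
  have hN0 : 0 ≤ upperNormSq d a :=
    Finset.sum_nonneg fun j _ => Finset.sum_nonneg fun i _ => sq_nonneg _
  set C := ∑ j ∈ Finset.range d, ∑ i ∈ Finset.range j, ‖a i j‖ * (‖b i‖ * ‖b j‖) with hC
  set D := ∑ j ∈ Finset.range d, ∑ i ∈ Finset.range j, ‖b i‖ ^ 2 * ‖b j‖ ^ 2 with hD
  have hD' : D ≤ y ^ 2 / 2 := sum_range_sum_range_mul_le d _ fun i => sq_nonneg _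
  have hsum : upperNormSq d (fun i j => a i j + b i * star (b j)) ≤ upperNormSq d a + 2 * C + D := by
    simp only [upperNormSq, hC, hD, Finset.mul_sum, ← Finset.sum_add_distrib]
    refine Finset.sum_le_sum fun j _ => Finset.sum_le_sum fun i _ => ?_
    have h1 : ‖a i j + b i * star (b j)‖ ≤ ‖a i j‖ + ‖b i‖ * ‖b j‖ := by
      simpa using norm_add_le (a i j) (b i * star (b j))
    nlinarith [norm_nonneg (a i j + b i * star (b j))]
  have hC' : y * (2 * C) ≤ 4 * y ^ 2 * upperNormSq d a + D / 4 := by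
    simp only [upperNormSq, hC, hD, Finset.mul_sum, Finset.sum_div, ← Finset.sum_add_distrib]
    refine Finset.sum_le_sum fun j _ => Finset.sum_le_sum fun i _ => ?_
    nlinarith [sq_nonneg (2 * y * ‖a i j‖ - ‖b i‖ * ‖b j‖ / 2)]
  rcases hy0.eq_or_lt with h0 | hpos
  · have hb : ∀ i ∈ Finset.range d, ‖b i‖ ^ 2 = 0 :=
      (Finset.sum_eq_zero_iff_of_nonneg fun i _ => sq_nonneg _).1 (hy ▸ h0.symm)
    have hC0 : C = 0 := by
      refine Finset.sum_eq_zero fun j hj => Finset.sum_eq_zero fun i _ => ?_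
      have : ‖b j‖ = 0 := by simpa using hb j hj
      simp [this]
    nlinarith
  · have h2 : 2 * C ≤ 4 * y * upperNormSq d a + y / 8 := by
      refine le_of_mul_le_mul_left (hC'.trans ?_) hpos
      nlinarith
    nlinarith

/-- Decoupling-free exponential bound for the off-diagonal quadratic forms of `U i ψ`, realised
simultaneously for finitely many coefficient arrays and unit vectors. -/
theorem exists_unitaries_sum_exp_chaos_le [FiniteDimensional ℂ E] (hE : 0 < Module.finrank ℂ E)
    {ι : Type*} [Fintype ι] (ψ : ι → E) (hψ : ∀ k, ‖ψ k‖ = 1) (d : ℕ)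
    (c : ι → ℝ) (hc : ∀ k, 0 ≤ c k) (a : ι → ℕ → ℕ → ℂ) (ha : ∀ k, upperNormSq d (a k) ≤ 1 / 64) :
    ∃ U : ℕ → E ≃ₗᵢ[ℂ] E,
      ∑ k, c k * Real.exp (Module.finrank ℂ E * chaos d (a k) fun i => U i (ψ k)) ≤
        ∑ k, c k * Real.exp (Module.finrank ℂ E * upperNormSq d (a k)) := by
  set n := Module.finrank ℂ E with hn
  have hn0 : (0 : ℝ) < n := by exact_mod_cast hE
  induction d generalizing c a with
  | zero => exact ⟨fun _ => .refl ℂ E, by simp [chaos, upperNormSq]⟩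
  | succ d ih =>
    let b : ι → ℕ → ℂ := fun k i => a k i d
    let y : ι → ℝ := fun k => ∑ i ∈ Finset.range d, ‖b k i‖ ^ 2
    let a' : ι → ℕ → ℕ → ℂ := fun k i j => a k i j + b k i * star (b k j)
    have hsucc (k) : upperNormSq (d + 1) (a k) = upperNormSq d (a k) + y k := by
      simp [upperNormSq, Finset.sum_range_succ, y, b]
    have hle (k) : upperNormSq d (a' k) + y k / 2 ≤ upperNormSq (d + 1) (a k) := by
      rw [hsucc]
      exact upperNormSq_add_mul_le d (a k) (b k) (hsucc k ▸ ha k)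
    have hy0 (k) : 0 ≤ y k := Finset.sum_nonneg fun i _ => sq_nonneg _
    obtain ⟨U, hU⟩ := ih (fun k => c k * Real.exp (n * (y k / 2)))
      (fun k => mul_nonneg (hc k) (Real.exp_pos _).le) a'
      (fun k => by linarith [hle k, ha k, hy0 k])
    let w : ι → E := fun k => ∑ i ∈ Finset.range d, star (b k i) • U i (ψ k)
    obtain ⟨V, hV⟩ := exists_unitary_sum_exp_le hE
      (fun k => c k * Real.exp (n * chaos d (a k) fun i => U i (ψ k)))
      (fun k => mul_nonneg (hc k) (Real.exp_pos _).le) (fun k => ((n : ℝ) : ℂ) • w k) ψ hψ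
    refine ⟨Function.update U d V, ?_⟩
    calc _ = ∑ k, c k * Real.exp (n * chaos d (a k) fun i => U i (ψ k)) *
          Real.exp (inner ℂ (((n : ℝ) : ℂ) • w k) (V (ψ k))).re := by
          refine Finset.sum_congr rfl fun k _ => ?_
          rw [mul_assoc, ← Real.exp_add, chaos, Finset.sum_range_succ, ← chaos,
            chaos_congr (w := fun i => U i (ψ k))
              fun i hi => by rw [Function.update_of_ne hi.ne], inner_smul_left, mul_add]
          congr 3
          rw [Complex.conj_ofReal, Complex.re_ofReal_mul]
          congr 1
          simp only [w, sum_inner, inner_smul_left, RCLike.star_def, Complex.conj_conj,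
            Function.update_self, Complex.re_sum]
          refine Finset.sum_congr rfl fun i hi => ?_
          rw [Function.update_of_ne (Finset.mem_range.1 hi).ne]
      _ ≤ _ := hV
      _ = ∑ k, c k * Real.exp (n * (y k / 2)) *
          Real.exp (n * chaos d (a' k) fun i => U i (ψ k)) := by
          refine Finset.sum_congr rfl fun k _ => ?_
          rw [mul_assoc, mul_assoc, ← Real.exp_add, ← Real.exp_add]
          congr 2
          have h1 : ‖w k‖ ^ 2 = y k +
              2 * chaos d (fun i j => b k i * star (b k j)) (fun i => U i (ψ k)) := by
            rw [norm_sq_sum_smul]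
            simp [hψ, y]
          have h2 : chaos d (a' k) (fun i => U i (ψ k)) = chaos d (a k) (fun i => U i (ψ k)) +
              chaos d (fun i j => b k i * star (b k j)) (fun i => U i (ψ k)) := by
            simp only [chaos, a', add_mul, Complex.add_re, Finset.sum_add_distrib]
          rw [norm_smul, mul_pow, h1, h2, Complex.norm_real, Real.norm_eq_abs, sq_abs, ← hn]
          field_simp
          ring
      _ ≤ _ := hU
      _ ≤ _ := by
          refine Finset.sum_le_sum fun k _ => ?_
          rw [mul_assoc, ← Real.exp_add, ← mul_add]
          refine mul_le_mul_of_nonneg_left (Real.exp_le_exp.2 ?_) (hc k)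
          exact mul_le_mul_of_nonneg_left (by linarith [hle k]) hn0.le

end Chaos

section Nets

theorem exists_finset_sphere_net (E : Type*) [NormedAddCommGroup E] [NormedSpace ℂ E]
    [FiniteDimensional ℂ E] :
    ∃ s : Finset E, (∀ x ∈ s, ‖x‖ = 1) ∧ s.card ≤ 25 ^ Module.finrank ℂ E ∧
      ∀ y : E, ‖y‖ = 1 → ∃ x ∈ s, ‖y - x‖ ≤ 1 / 2 := by
  classical
  let _ : NormedSpace ℝ E := NormedSpace.restrictScalars ℝ ℂ E
  have : FiniteDimensional ℝ E := FiniteDimensional.complexToReal E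
  let P : Finset E → Prop := fun s => (∀ x ∈ s, ‖x‖ = 1) ∧
    ∀ x ∈ s, ∀ y ∈ s, x ≠ y → 1 / 2 < ‖x - y‖
  have hcard (s : Finset E) (hs : P s) : s.card ≤ 25 ^ Module.finrank ℂ E := by
    have hinj : Function.Injective fun x : E => (2 : ℝ) • x :=
      smul_right_injective E two_ne_zero
    have h := Besicovitch.card_le_of_separated (s.image fun x => (2 : ℝ) • x)
      (by simpa [norm_smul] using fun x hx => (hs.1 x hx).le) (by
        simp only [Finset.mem_image]
        rintro _ ⟨x, hx, rfl⟩ _ ⟨y, hy, rfl⟩ hxy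
        rw [← smul_sub, norm_smul]
        have := hs.2 x hx y hy (fun h => hxy (by rw [h]))
        norm_num
        linarith)
    rw [Finset.card_image_of_injective _ hinj, finrank_real_of_complex, pow_mul] at h
    simpa using h
  obtain ⟨s, hs, hmax⟩ : ∃ s, P s ∧ ∀ t, P t → t.card ≤ s.card := by
    obtain ⟨s, hs, hm⟩ := Nat.findGreatest_spec (P := fun m => ∃ s, P s ∧ s.card = m)
      (Nat.zero_le (25 ^ Module.finrank ℂ E)) ⟨∅, by simp [P], rfl⟩
    exact ⟨s, hs, fun t ht => hm ▸ Nat.le_findGreatest (hcard t ht) ⟨t, ht, rfl⟩⟩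
  refine ⟨s, hs.1, hcard s hs, fun y hy => ?_⟩
  by_contra! hfar
  have hys : y ∉ s := fun h => by
    have := hfar y h
    rw [sub_self, norm_zero] at this
    linarith
  have := hmax (insert y s) ⟨by simpa [hy] using hs.1, by
    intro a ha b hb hab
    rcases Finset.mem_insert.1 ha with ha' | ha' <;>
      rcases Finset.mem_insert.1 hb with hb' | hb'
    · exact absurd (ha'.trans hb'.symm) hab
    · exact ha' ▸ hfar b hb'
    · rw [norm_sub_rev]; exact hb' ▸ hfar a ha'
    · exact hs.2 a ha' b hb' hab⟩
  rw [Finset.card_insert_of_notMem hys] at this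
  omega

/-- A quadratic map bounded on a `1/2`-net of the unit sphere is bounded on the unit sphere. -/
theorem norm_quadratic_le_of_net {E F : Type*} [NormedAddCommGroup E] [InnerProductSpace ℂ E]
    [FiniteDimensional ℂ E] [SeminormedAddCommGroup F] {q : E → F} (hq : Continuous q)
    (hsmul : ∀ (r : ℝ) x, ‖q ((r : ℂ) • x)‖ = r ^ 2 * ‖q x‖)
    (hdiff : ∀ x y, q (x + y) - q (x - y) =
      q ((1 / 2 : ℂ) • x + (2 : ℂ) • y) - q ((1 / 2 : ℂ) • x - (2 : ℂ) • y))
    {s : Set E} (hs1 : ∀ x ∈ s, ‖x‖ = 1) (hs : ∀ y : E, ‖y‖ = 1 → ∃ x ∈ s, ‖y - x‖ ≤ 1 / 2)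
    {t : ℝ} (ht : ∀ x ∈ s, ‖q x‖ ≤ t) {y : E} (hy : ‖y‖ = 1) : ‖q y‖ ≤ 32 * t := by
  have : ProperSpace E := FiniteDimensional.proper ℂ E
  obtain ⟨z, hz, hmax⟩ := (isCompact_sphere (0 : E) 1).exists_isMaxOn ⟨y, by simpa using hy⟩
    hq.norm.continuousOn
  rw [mem_sphere_zero_iff_norm] at hz
  have hM (x : E) : ‖q x‖ ≤ ‖q z‖ * ‖x‖ ^ 2 := by
    rcases eq_or_ne x 0 with rfl | hx
    · have := hsmul 0 z
      simp at this
      simp [this]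
    · have hx' : ‖x‖ ≠ 0 := norm_ne_zero_iff.2 hx
      have h1 := hsmul ‖x‖ (((‖x‖⁻¹ : ℝ) : ℂ) • x)
      rw [smul_smul, ← Complex.ofReal_mul, mul_inv_cancel₀ hx', Complex.ofReal_one, one_smul] at h1
      rw [h1, mul_comm]
      refine mul_le_mul_of_nonneg_right (hmax ?_) (sq_nonneg _)
      simp [norm_smul, hx']
  obtain ⟨x, hx, hzx⟩ := hs z hz
  have key := hdiff ((1 / 2 : ℂ) • (z + x)) ((1 / 2 : ℂ) • (z - x))
  have e1 : (1 / 2 : ℂ) • (z + x) + (1 / 2 : ℂ) • (z - x) = z := by module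
  have e2 : (1 / 2 : ℂ) • (z + x) - (1 / 2 : ℂ) • (z - x) = x := by module
  rw [e1, e2, smul_smul, smul_smul] at key
  set p := ((1 / 2 : ℂ) * (1 / 2)) • (z + x) with hp
  set r := ((2 : ℂ) * (1 / 2)) • (z - x) with hr
  have hpar : ‖p + r‖ ^ 2 + ‖p - r‖ ^ 2 ≤ 31 / 32 := by
    have h1 := parallelogram_law_with_norm ℂ p r
    have h2 := parallelogram_law_with_norm ℂ z x
    have h3 : ‖p‖ = ‖z + x‖ / 4 := by
      rw [hp, norm_smul]; norm_num; ring
    have h4 : ‖r‖ = ‖z - x‖ := by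
      rw [hr, norm_smul]; norm_num
    rw [hz, hs1 x hx] at h2
    rw [h3, h4] at h1
    nlinarith [norm_nonneg (z - x)]
  have h5 : ‖q z‖ ≤ ‖q x‖ + (‖q (p + r)‖ + ‖q (p - r)‖) := by
    have : q z = q x + (q (p + r) - q (p - r)) := by rw [← key]; abel
    rw [this]
    exact (norm_add_le _ _).trans (add_le_add_right (norm_sub_le _ _) _)
  have h6 : ‖q y‖ ≤ ‖q z‖ := hmax (by simpa using hy)
  have h7 := ht x hx
  have h8 := hM (p + r)
  have h9 := hM (p - r)
  nlinarith [norm_nonneg (q z)]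

theorem exists_finset_dual_net (F : Type*) [NormedAddCommGroup F] [InnerProductSpace ℂ F]
    [FiniteDimensional ℂ F] :
    ∃ A : Finset F, (∀ a ∈ A, ‖a‖ = 1 / 8) ∧
      ∀ x : F, x ≠ 0 → ∃ a ∈ A, ‖x‖ ≤ 16 * (inner ℂ a x).re := by
  have : ProperSpace F := FiniteDimensional.proper ℂ F
  obtain ⟨A, hA, hAf, hcov⟩ := (isCompact_sphere (0 : F) (1 / 8)).finite_cover_balls
    (show (0 : ℝ) < 1 / 16 by norm_num)
  refine ⟨hAf.toFinset, fun a ha => by simpa using hA (hAf.mem_toFinset.1 ha), fun x hx => ?_⟩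
  have hx' : 0 < ‖x‖ := norm_pos_iff.2 hx
  set e : F := ((1 / 8 * ‖x‖⁻¹ : ℝ) : ℂ) • x with he
  have hmem : e ∈ Metric.sphere (0 : F) (1 / 8) := by
    simp [e, norm_smul, hx'.ne']
  obtain ⟨a, ha, hae⟩ := Set.mem_iUnion₂.1 (hcov hmem)
  refine ⟨a, hAf.mem_toFinset.2 ha, ?_⟩
  rw [Metric.mem_ball, dist_eq_norm] at hae
  have h1 : (inner ℂ e x).re = 1 / 8 * ‖x‖ := by
    have h : (inner ℂ x x).re = ‖x‖ ^ 2 := inner_self_eq_norm_sq (𝕜 := ℂ) x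
    rw [he, inner_smul_left, Complex.conj_ofReal, Complex.re_ofReal_mul, h]
    field_simp
  have h2 : (inner ℂ (e - a) x).re ≤ 1 / 16 * ‖x‖ :=
    (Complex.re_le_norm _).trans ((norm_inner_le_norm _ _).trans
      (mul_le_mul_of_nonneg_right hae.le hx'.le))
  rw [inner_sub_left, Complex.sub_re, h1] at h2
  linarith

end Nets

section Gram

/-- The pairs `(j, i)` with `i < j < d`. -/
abbrev pairs (d : ℕ) : Finset (Σ _ : ℕ, ℕ) := (Finset.range d).sigma fun j => Finset.range j

variable {E : Type*} [NormedAddCommGroup E] [InnerProductSpace ℂ E]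

/-- The overlaps `⟪U i ψ, U j ψ⟫` for `i < j < d`. -/
noncomputable def overlaps (U : ℕ → E ≃ₗᵢ[ℂ] E) (d : ℕ) (ψ : E) : EuclideanSpace ℂ (pairs d) :=
  WithLp.toLp 2 fun p => inner ℂ (U p.1.2 ψ) (U p.1.1 ψ)

/-- Extension by zero of an array indexed by `pairs d`. -/
noncomputable def ofPairs {d : ℕ} (a : EuclideanSpace ℂ (pairs d)) (i j : ℕ) : ℂ :=
  if h : (⟨j, i⟩ : Σ _ : ℕ, ℕ) ∈ pairs d then a ⟨_, h⟩ else 0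

theorem sum_pairs (d : ℕ) (f : ℕ → ℕ → ℝ) :
    ∑ p : pairs d, f p.1.2 p.1.1 = ∑ j ∈ Finset.range d, ∑ i ∈ Finset.range j, f i j := by
  rw [Finset.sum_coe_sort (pairs d) (fun p => f p.2 p.1), Finset.sum_sigma]

theorem upperNormSq_ofPairs {d : ℕ} (a : EuclideanSpace ℂ (pairs d)) :
    upperNormSq d (fun i j => star (ofPairs a i j)) = ‖a‖ ^ 2 := by
  rw [upperNormSq, ← sum_pairs, EuclideanSpace.norm_sq_eq]
  refine Finset.sum_congr rfl fun p _ => ?_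
  simp only [norm_star, ofPairs]
  rw [dif_pos p.2]

theorem chaos_ofPairs {d : ℕ} (a : EuclideanSpace ℂ (pairs d)) (U : ℕ → E ≃ₗᵢ[ℂ] E) (ψ : E) :
    chaos d (fun i j => star (ofPairs a i j)) (fun i => U i ψ) =
      (inner ℂ a (overlaps U d ψ)).re := by
  rw [chaos, ← sum_pairs d fun i j => (star (ofPairs a i j) * inner ℂ (U i ψ) (U j ψ)).re,
    PiLp.inner_apply, Complex.re_sum]
  refine Finset.sum_congr rfl fun p _ => ?_
  simp only [ofPairs]
  rw [dif_pos p.2]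
  simp [overlaps, mul_comm]

theorem norm_overlaps_sq (U : ℕ → E ≃ₗᵢ[ℂ] E) (d : ℕ) (ψ : E) :
    ‖overlaps U d ψ‖ ^ 2 = upperNormSq d fun i j => inner ℂ (U i ψ) (U j ψ) := by
  rw [upperNormSq, ← sum_pairs d fun i j => ‖inner ℂ (U i ψ) (U j ψ)‖ ^ 2,
    EuclideanSpace.norm_sq_eq]
  rfl

/-- For every number `d` of unitaries, a large dimension admits unitaries such that the
off-diagonal parts of all Gram matrices of the vectors `U i ψ` are bounded independently of `d`. -/
theorem exists_unitaries_upperNormSq_le :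
    ∃ C : ℝ, ∀ d : ℕ, ∃ n : ℕ, 0 < n ∧
      ∃ U : ℕ → EuclideanSpace ℂ (Fin n) ≃ₗᵢ[ℂ] EuclideanSpace ℂ (Fin n),
        ∀ ψ, ‖ψ‖ = 1 → upperNormSq d (fun i j => inner ℂ (U i ψ) (U j ψ)) ≤ C := by
  refine ⟨(32 * 432) ^ 2, fun d => ?_⟩
  obtain ⟨A, hA, hAnet⟩ := exists_finset_dual_net (EuclideanSpace ℂ (pairs d))
  set n := A.card + 1 with hn
  have hn0 : (0 : ℝ) < n := by positivity
  refine ⟨n, Nat.succ_pos _, ?_⟩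
  obtain ⟨s, hs1, hscard, hsnet⟩ := exists_finset_sphere_net (EuclideanSpace ℂ (Fin n))
  have hrank : Module.finrank ℂ (EuclideanSpace ℂ (Fin n)) = n := by simp
  obtain ⟨U, hU⟩ := exists_unitaries_sum_exp_chaos_le (by rw [hrank]; exact Nat.succ_pos _)
    (fun k : s × A => k.1.1) (fun k => hs1 _ k.1.2) d (fun _ => 1) (fun _ => zero_le_one)
    (fun k i j => star (ofPairs k.2.1 i j))
    (fun k => by rw [upperNormSq_ofPairs, hA _ k.2.2]; norm_num)
  rw [hrank] at hU hscard
  refine ⟨U, ?_⟩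
  have hnet (x) (hx : x ∈ s) : ‖overlaps U d x‖ ≤ 432 := by
    rcases eq_or_ne (overlaps U d x) 0 with h0 | h0
    · rw [h0]; norm_num
    obtain ⟨a, ha, hle⟩ := hAnet _ h0
    have hsingle := Finset.single_le_sum (f := fun k : s × A => (1 : ℝ) *
      Real.exp (n * chaos d (fun i j => star (ofPairs k.2.1 i j)) fun i => U i k.1.1))
      (fun k _ => by positivity) (Finset.mem_univ (⟨⟨x, hx⟩, ⟨a, ha⟩⟩ : s × A))
    have hbound : Real.exp (n * (inner ℂ a (overlaps U d x)).re) ≤ Real.exp (n * 27) := by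
      calc _ ≤ ∑ k : s × A, (1 : ℝ) *
            Real.exp (n * chaos d (fun i j => star (ofPairs k.2.1 i j)) fun i => U i k.1.1) := by
            rw [← chaos_ofPairs]
            simpa only [one_mul] using hsingle
        _ ≤ _ := by simpa using hU
        _ = (s.card * A.card : ℝ) * Real.exp (n * (1 / 64)) := by
          have (k : s × A) : ‖(k.2 : EuclideanSpace ℂ (pairs d))‖ ^ 2 = 1 / 64 := by
            rw [hA _ k.2.2]; norm_num
          simp only [← RCLike.star_def, upperNormSq_ofPairs, this]
          simp
        _ ≤ (Real.exp 25 ^ n * Real.exp n) * Real.exp n := by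
          have h1 : (s.card : ℝ) ≤ Real.exp 25 ^ n :=
            (by exact_mod_cast hscard : (s.card : ℝ) ≤ 25 ^ n).trans
              (pow_le_pow_left₀ (by norm_num) (by linarith [Real.add_one_le_exp 25]) n)
          have h2 : (A.card : ℝ) ≤ Real.exp n := by
            have := Real.add_one_le_exp (n : ℝ)
            have h3 : (n : ℝ) = A.card + 1 := by simp [hn]
            linarith
          gcongr
          linarith
        _ = _ := by
          rw [← Real.exp_nat_mul, ← Real.exp_add, ← Real.exp_add]
          ring_nf
    have := le_of_mul_le_mul_left (Real.exp_le_exp.1 hbound) hn0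
    linarith
  intro ψ hψ
  rw [← norm_overlaps_sq]
  refine pow_le_pow_left₀ (norm_nonneg _) ?_ 2
  refine norm_quadratic_le_of_net (q := overlaps U d) ?_ ?_ ?_ (s := s) hs1 hsnet hnet hψ
  · unfold overlaps
    fun_prop
  · intro r x
    have : overlaps U d ((r : ℂ) • x) = ((r ^ 2 : ℝ) : ℂ) • overlaps U d x := by
      ext p
      simp only [overlaps, map_smul, inner_smul_left, inner_smul_right, Complex.conj_ofReal,
        PiLp.smul_apply, smul_eq_mul]
      push_cast
      ring
    rw [this, norm_smul, Complex.norm_real, Real.norm_eq_abs, abs_of_nonneg (sq_nonneg r)]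
  · intro x y
    ext p
    simp only [overlaps, map_add, map_sub, map_smul, inner_smul_left, inner_smul_right,
      inner_add_left, inner_add_right, inner_sub_left, inner_sub_right, PiLp.sub_apply, map_div₀,
      map_one, map_ofNat]
    ring

end Gram

section Entropy

theorem neg_mul_log_le {x t : ℝ} (hx : 0 ≤ x) (ht : 0 < t) :
    -(x * Real.log x) ≤ -(x * Real.log t) + (if x = 0 then 0 else t) - x := by
  rcases hx.eq_or_lt with rfl | hx
  · simp
  have h := mul_le_mul_of_nonneg_left (Real.log_le_sub_one_of_pos (div_pos ht hx)) hx.le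
  rw [Real.log_div ht.ne' hx.ne', mul_sub, mul_sub, mul_div_cancel₀ _ hx.ne'] at h
  rw [if_neg hx.ne']
  linarith

theorem le_neg_mul_log {x s : ℝ} (hx : 0 ≤ x) (hs : 0 < s) :
    -(x * Real.log s) - (x ^ 2 / s - x) ≤ -(x * Real.log x) := by
  rcases hx.eq_or_lt with rfl | hx
  · simp
  have h := mul_le_mul_of_nonneg_left (Real.log_le_sub_one_of_pos (div_pos hx hs)) hx.le
  rw [Real.log_div hx.ne' hs.ne', mul_sub, mul_sub, ← mul_div_assoc, ← sq] at h
  linarith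

variable {m : Type*} [Fintype m] [DecidableEq m] {A : Matrix m m ℂ}

theorem sum_eigenvalues_eq_one (hA : A.IsHermitian) (ht : A.trace = 1) :
    ∑ i, hA.eigenvalues i = 1 := by
  have := congrArg Complex.re hA.trace_eq_sum_eigenvalues
  simpa [ht] using this.symm

theorem sum_eigenvalues_sq (hA : A.IsHermitian) :
    ∑ i, hA.eigenvalues i ^ 2 = ∑ a, ∑ b, ‖A a b‖ ^ 2 := by
  have h1 : (A * A).trace = ∑ a, ∑ b, ((‖A a b‖ ^ 2 : ℝ) : ℂ) := by
    simp only [trace, diag_apply, mul_apply]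
    refine Finset.sum_congr rfl fun a _ => Finset.sum_congr rfl fun b _ => ?_
    rw [← hA.apply b a, Complex.ofReal_pow, ← Complex.mul_conj']
    rfl
  have h2 : (A * A).trace = ∑ i, ((hA.eigenvalues i ^ 2 : ℝ) : ℂ) := by
    conv_lhs => rw [hA.spectral_theorem, ← map_mul, Unitary.conjStarAlgAut_apply,
      trace_mul_cycle, Unitary.coe_star_mul_self, one_mul, diagonal_mul_diagonal, trace_diagonal]
    simp [sq]
  rw [h1] at h2
  exact_mod_cast h2.symm

/-- The expectation of `A` at a unit vector does not exceed the largest eigenvalue. -/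
theorem exists_le_eigenvalues (hA : A.IsHermitian) {x : m → ℂ} (hx : star x ⬝ᵥ x = 1) {c : ℝ}
    (hc : c ≤ (star x ⬝ᵥ A *ᵥ x).re) : ∃ i, c ≤ hA.eigenvalues i := by
  by_contra! h
  set y : m → ℂ := star (hA.eigenvectorUnitary : Matrix m m ℂ) *ᵥ x with hy
  have hstar : star y = star x ᵥ* (hA.eigenvectorUnitary : Matrix m m ℂ) := by
    rw [hy, star_mulVec, star_eq_conjTranspose, conjTranspose_conjTranspose]
  have h1 : ∑ i, ‖y i‖ ^ 2 = 1 := by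
    have : star y ⬝ᵥ y = 1 := by
      rw [hstar, hy, ← dotProduct_mulVec, mulVec_mulVec, 
        Unitary.mul_star_self_of_mem hA.eigenvectorUnitary.2, one_mulVec, hx]
    have h2 : star y ⬝ᵥ y = ((∑ i, ‖y i‖ ^ 2 : ℝ) : ℂ) := by
      simp only [dotProduct, Pi.star_apply, RCLike.star_def, Complex.conj_mul']
      push_cast; rfl
    rw [h2] at this
    exact_mod_cast this
  have h2 : star x ⬝ᵥ A *ᵥ x = ((∑ i, hA.eigenvalues i * ‖y i‖ ^ 2 : ℝ) : ℂ) := by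
    conv_lhs => rw [hA.spectral_theorem, Unitary.conjStarAlgAut_apply, ← mulVec_mulVec,
      ← mulVec_mulVec, dotProduct_mulVec, ← hstar, ← hy]
    simp only [dotProduct, mulVec_diagonal, Pi.star_apply, Function.comp_apply]
    push_cast
    refine Finset.sum_congr rfl fun i _ => ?_
    rw [← Complex.conj_mul']
    simp only [RCLike.star_def, Complex.coe_algebraMap]
    ring
  rw [h2, Complex.ofReal_re] at hc
  have h3 : ∑ i, (c - hA.eigenvalues i) * ‖y i‖ ^ 2 ≤ 0 := by
    simp only [sub_mul, Finset.sum_sub_distrib, ← Finset.mul_sum, h1]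
    linarith
  have h4 := (Finset.sum_eq_zero_iff_of_nonneg fun i _ =>
    mul_nonneg (sub_pos.2 (h i)).le (sq_nonneg ‖y i‖)).1 (h3.antisymm (Finset.sum_nonneg fun i _ =>
      mul_nonneg (sub_pos.2 (h i)).le (sq_nonneg ‖y i‖)))
  have h5 : ∑ i, ‖y i‖ ^ 2 = 0 := Finset.sum_eq_zero fun i hi =>
    (mul_eq_zero.1 (h4 i hi)).resolve_left (sub_pos.2 (h i)).ne'
  rw [h5] at h1
  exact zero_ne_one h1

theorem vnEntropy_nonneg (hA : A.PosSemidef) (ht : A.trace = 1) : 0 ≤ vnEntropy A := by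
  rw [vnEntropy, dif_pos hA.isHermitian, ← Finset.sum_neg_distrib]
  refine Finset.sum_nonneg fun i _ => ?_
  have h0 := hA.eigenvalues_nonneg
  have h1 : hA.isHermitian.eigenvalues i ≤ 1 :=
    (Finset.single_le_sum (fun j _ => h0 j) (Finset.mem_univ i)).trans_eq
      (sum_eigenvalues_eq_one hA.isHermitian ht)
  exact neg_nonneg.2 (mul_nonpos_of_nonneg_of_nonpos (h0 i) (Real.log_nonpos (h0 i) h1))

/-- The von Neumann entropy is at least the collision entropy. -/
theorem neg_log_le_vnEntropy (hA : A.PosSemidef) (ht : A.trace = 1) {s : ℝ} (hs : 0 < s)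
    (h : ∑ a, ∑ b, ‖A a b‖ ^ 2 ≤ s) : -Real.log s ≤ vnEntropy A := by
  rw [← sum_eigenvalues_sq hA.isHermitian] at h
  rw [vnEntropy, dif_pos hA.isHermitian, ← Finset.sum_neg_distrib]
  refine le_trans ?_ (Finset.sum_le_sum fun i _ => le_neg_mul_log (hA.eigenvalues_nonneg i) hs)
  rw [Finset.sum_sub_distrib, Finset.sum_sub_distrib, Finset.sum_neg_distrib, ← Finset.sum_mul,
    ← Finset.sum_div, sum_eigenvalues_eq_one hA.isHermitian ht]
  have := (div_le_one hs).2 h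
  linarith

/-- A state of rank at most `d ^ 2` with an expectation at least `1 / d` has entropy noticeably
smaller than `log (d ^ 2)`. -/
theorem vnEntropy_le (hA : A.PosSemidef) (ht : A.trace = 1) {d : ℕ} (hd : 0 < d)
    (hrank : A.rank ≤ d * d) {x : m → ℂ} (hx : star x ⬝ᵥ x = 1)
    (hc : 1 / d ≤ (star x ⬝ᵥ A *ᵥ x).re) :
    vnEntropy A ≤ 2 * Real.log d - Real.log d / d + 1 / d := by
  have hd' : (0 : ℝ) < d := Nat.cast_pos.2 hd
  obtain ⟨k, hk⟩ := exists_le_eigenvalues hA.isHermitian hx hc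
  have hlog : 0 ≤ Real.log d := Real.log_natCast_nonneg d
  set l := hA.isHermitian.eigenvalues with hl
  have hl0 : ∀ i, 0 ≤ l i := hA.eigenvalues_nonneg
  have hl1 : ∑ i, l i = 1 := sum_eigenvalues_eq_one hA.isHermitian ht
  have hcard : ((Finset.univ.filter fun i => l i ≠ 0).card : ℝ) ≤ d * d := by
    rw [hA.isHermitian.rank_eq_card_non_zero_eigs, Fintype.card_subtype] at hrank
    exact_mod_cast hrank
  rw [vnEntropy, dif_pos hA.isHermitian, ← Finset.sum_neg_distrib]
  have hterm (i : m) : -(l i * Real.log (l i)) ≤ 2 * Real.log d * l i - l i +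
      (if l i ≠ 0 then 1 / ((d : ℝ) * d) else 0) +
      if i = k then 1 / (d : ℝ) - Real.log d * l i else 0 := by
    have hpos : 0 < 1 / ((d : ℝ) * d) := by positivity
    by_cases hik : i = k
    · refine (neg_mul_log_le (hl0 i) (one_div_pos.2 hd')).trans ?_
      rw [one_div (d : ℝ), Real.log_inv, if_pos hik, ← one_div]
      have h2 : 0 < 1 / (d : ℝ) := by positivity
      split_ifs <;> first | contradiction | linarith
    · refine (neg_mul_log_le (hl0 i) hpos).trans ?_
      rw [one_div ((d : ℝ) * d), Real.log_inv, Real.log_mul hd'.ne' hd'.ne', if_neg hik, ← one_div]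
      split_ifs <;> first | contradiction | linarith
  refine (Finset.sum_le_sum fun i _ => hterm i).trans ?_
  rw [Finset.sum_add_distrib, Finset.sum_add_distrib, Finset.sum_sub_distrib, ← Finset.mul_sum, hl1,
    Finset.sum_ite_eq' Finset.univ k, if_pos (Finset.mem_univ k), ← Finset.sum_filter,
    Finset.sum_const, nsmul_eq_mul]
  have h1 : ((Finset.univ.filter fun i => l i ≠ 0).card : ℝ) * (1 / (d * d)) ≤ 1 := by
    rw [mul_one_div]
    exact (div_le_one (by positivity)).2 hcard
  have h2 : Real.log d / d ≤ Real.log d * l k := by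
    rw [div_eq_mul_one_div]
    exact mul_le_mul_of_nonneg_left hk hlog
  linarith

end Entropy

section Mixture

variable {ι m : Type*} [Fintype ι] [Fintype m]

/-- The mixture of the conjugations `ρ ↦ V i ρ (V i)ᴴ` with weights `w i`. -/
noncomputable def mixture (w : ι → ℝ) (V : ι → Matrix m m ℂ) (ρ : Matrix m m ℂ) : Matrix m m ℂ :=
  ∑ i, (w i : ℂ) • (V i * ρ * (V i)ᴴ)

variable {w : ι → ℝ} {V : ι → Matrix m m ℂ} {ρ : Matrix m m ℂ}

theorem mixture_posSemidef (hw : ∀ i, 0 ≤ w i) (hρ : ρ.PosSemidef) : (mixture w V ρ).PosSemidef :=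
  posSemidef_sum _ fun i _ =>
    (hρ.mul_mul_conjTranspose_same (V i)).smul (Complex.zero_le_real.2 (hw i))

theorem mixture_sum {κ : Type*} [Fintype κ] (p : κ → ℝ) (r : κ → Matrix m m ℂ) :
    mixture w V (∑ k, (p k : ℂ) • r k) = ∑ k, (p k : ℂ) • mixture w V (r k) := by
  simp only [mixture, Finset.mul_sum, Finset.sum_mul, Finset.smul_sum, Matrix.mul_smul,
    Matrix.smul_mul]
  rw [Finset.sum_comm]
  exact Finset.sum_congr rfl fun k _ => Finset.sum_congr rfl fun i _ => smul_comm _ _ _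

theorem mixture_vecMulVec (x : m → ℂ) : mixture w V (vecMulVec x (star x)) =
    ∑ i, (w i : ℂ) • vecMulVec (V i *ᵥ x) (star (V i *ᵥ x)) := by
  simp only [mixture, mul_vecMulVec, vecMulVec_mul, star_mulVec]

theorem rank_mixture_vecMulVec_le (x : m → ℂ) :
    (mixture w V (vecMulVec x (star x))).rank ≤ Fintype.card ι := by
  have : mixture w V (vecMulVec x (star x)) =
      (of fun a i => (w i : ℂ) * (V i *ᵥ x) a) * (of fun i b => star ((V i *ᵥ x) b)) := by
    ext a b
    simp only [mixture_vecMulVec, mul_apply, Matrix.sum_apply, Matrix.smul_apply, vecMulVec_apply,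
      Pi.star_apply, of_apply, smul_eq_mul, mul_assoc]
  rw [this]
  exact (rank_mul_le_left _ _).trans (rank_le_card_width _)

theorem re_dotProduct_mixture_vecMulVec (x : m → ℂ) :
    (star x ⬝ᵥ mixture w V (vecMulVec x (star x)) *ᵥ x).re =
      ∑ i, w i * ‖star x ⬝ᵥ V i *ᵥ x‖ ^ 2 := by
  rw [mixture_vecMulVec, sum_mulVec, dotProduct_sum, Complex.re_sum]
  refine Finset.sum_congr rfl fun i _ => ?_
  have h : star (V i *ᵥ x) ⬝ᵥ x = star (star x ⬝ᵥ V i *ᵥ x) := by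
    rw [star_dotProduct]
  rw [smul_mulVec, dotProduct_smul, vecMulVec_mulVec, dotProduct_smul, h, smul_eq_mul,
    MulOpposite.smul_eq_mul_unop, MulOpposite.unop_op, RCLike.star_def, Complex.mul_conj']
  norm_cast

theorem sum_norm_sq_sum_vecMulVec (v : ι → m → ℂ) :
    ∑ a, ∑ b, ‖∑ i, v i a * star (v i b)‖ ^ 2 = ∑ i, ∑ j, ‖star (v i) ⬝ᵥ v j‖ ^ 2 := by
  have h : ∑ a, ∑ b, (∑ i, v i a * star (v i b)) * star (∑ i, v i a * star (v i b)) =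
      ∑ i, ∑ j, (star (v i) ⬝ᵥ v j) * star (star (v i) ⬝ᵥ v j) := by
    simp only [dotProduct, star_sum, Finset.sum_mul_sum, star_mul, star_star, Pi.star_apply]
    calc _ = ∑ a, ∑ i, ∑ j, ∑ b, v i a * star (v i b) * (v j b * star (v j a)) := by
          refine Finset.sum_congr rfl fun a _ => ?_
          rw [Finset.sum_comm]
          exact Finset.sum_congr rfl fun i _ => Finset.sum_comm
      _ = ∑ i, ∑ j, ∑ a, ∑ b, v i a * star (v i b) * (v j b * star (v j a)) := by
          rw [Finset.sum_comm]
          exact Finset.sum_congr rfl fun i _ => Finset.sum_comm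
      _ = _ := by
          refine Finset.sum_congr rfl fun i _ => Finset.sum_congr rfl fun j _ => ?_
          rw [Finset.sum_comm]
          refine Finset.sum_congr rfl fun a _ => Finset.sum_congr rfl fun b _ => ?_
          ring
  simp only [RCLike.star_def, Complex.mul_conj'] at h
  exact_mod_cast h

variable [DecidableEq m]

theorem trace_mixture (hw : ∑ i, w i = 1) (hV : ∀ i, V i ∈ unitaryGroup m ℂ) :
    (mixture w V ρ).trace = ρ.trace := by
  have h (i : ι) : (V i * ρ * (V i)ᴴ).trace = ρ.trace := by
    rw [trace_mul_cycle, ← star_eq_conjTranspose, mem_unitaryGroup_iff'.1 (hV i), one_mul]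
  simp only [mixture, trace_sum, trace_smul, h, ← Finset.sum_smul]
  rw [← Complex.ofReal_sum, hw, Complex.ofReal_one, one_smul]

theorem eq_sum_eigenvalues_smul_vecMulVec (hρ : ρ.IsHermitian) :
    ∃ v : m → m → ℂ, (∀ k, star (v k) ⬝ᵥ v k = 1) ∧
      ρ = ∑ k, (hρ.eigenvalues k : ℂ) • vecMulVec (v k) (star (v k)) := by
  refine ⟨fun k a => (hρ.eigenvectorUnitary : Matrix m m ℂ) a k, fun k => ?_, ?_⟩
  · have h : star (hρ.eigenvectorUnitary : Matrix m m ℂ) * hρ.eigenvectorUnitary = 1 :=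
      Unitary.star_mul_self_of_mem hρ.eigenvectorUnitary.2
    have := congrFun (congrFun h k) k
    rw [mul_apply, one_apply_eq] at this
    exact this
  · conv_lhs => rw [hρ.spectral_theorem, Unitary.conjStarAlgAut_apply]
    ext a b
    rw [mul_apply, Matrix.sum_apply]
    refine Finset.sum_congr rfl fun k _ => ?_
    rw [mul_diagonal, Matrix.smul_apply, vecMulVec_apply, star_apply, smul_eq_mul, Pi.star_apply]
    simp only [Function.comp_apply, Complex.coe_algebraMap]
    ring

/-- The purity of the outputs of a uniform mixture of conjugations is governed by the overlaps
of the images of pure states. -/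
theorem sum_norm_sq_mixture_le {c K : ℝ}
    (hV : ∀ x : m → ℂ, star x ⬝ᵥ x = 1 → ∑ i, ∑ j, ‖star (V i *ᵥ x) ⬝ᵥ (V j *ᵥ x)‖ ^ 2 ≤ K)
    (hρ : ρ.PosSemidef) (ht : ρ.trace = 1) :
    ∑ a, ∑ b, ‖mixture (fun _ => c) V ρ a b‖ ^ 2 ≤ c ^ 2 * K := by
  obtain ⟨v, hv1, hv⟩ := eq_sum_eigenvalues_smul_vecMulVec hρ.isHermitian
  set p := hρ.isHermitian.eigenvalues
  have hp0 : ∀ k, 0 ≤ p k := hρ.eigenvalues_nonneg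
  have hp1 : ∑ k, p k = 1 := sum_eigenvalues_eq_one hρ.isHermitian ht
  have hpure (k : m) :
      ∑ a, ∑ b, ‖mixture (fun _ => c) V (vecMulVec (v k) (star (v k))) a b‖ ^ 2 ≤ c ^ 2 * K := by
    refine le_trans (le_of_eq ?_) (mul_le_mul_of_nonneg_left (hV _ (hv1 k)) (sq_nonneg c))
    rw [← sum_norm_sq_sum_vecMulVec, Finset.mul_sum]
    refine Finset.sum_congr rfl fun a _ => ?_
    rw [Finset.mul_sum]
    refine Finset.sum_congr rfl fun b _ => ?_
    rw [mixture_vecMulVec, ← Finset.smul_sum, Matrix.smul_apply, norm_smul, mul_pow, Complex.norm_real,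
      Real.norm_eq_abs, sq_abs, Matrix.sum_apply]
    simp only [vecMulVec_apply, Pi.star_apply]
  have hentry (a b : m) : ‖mixture (fun _ => c) V ρ a b‖ ^ 2 ≤
      ∑ k, p k * ‖mixture (fun _ => c) V (vecMulVec (v k) (star (v k))) a b‖ ^ 2 := by
    refine le_trans ?_ (Real.pow_arith_mean_le_arith_mean_pow_of_even _ _ _ (fun k _ => hp0 k) hp1
      even_two)
    refine pow_le_pow_left₀ (norm_nonneg _) ?_ 2
    rw [hv, mixture_sum, Matrix.sum_apply]
    refine (norm_sum_le _ _).trans_eq (Finset.sum_congr rfl fun k _ => ?_)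
    rw [Matrix.smul_apply, norm_smul, Complex.norm_real, Real.norm_eq_abs, abs_of_nonneg (hp0 k)]
  calc _ ≤ ∑ a, ∑ b, ∑ k, p k *
        ‖mixture (fun _ => c) V (vecMulVec (v k) (star (v k))) a b‖ ^ 2 :=
        Finset.sum_le_sum fun a _ => Finset.sum_le_sum fun b _ => hentry a b
    _ = ∑ k, p k * ∑ a, ∑ b,
        ‖mixture (fun _ => c) V (vecMulVec (v k) (star (v k))) a b‖ ^ 2 := by
        simp only [Finset.mul_sum]
        rw [Finset.sum_comm]
        conv_rhs => rw [Finset.sum_comm]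
        rw [Finset.sum_comm]
        exact Finset.sum_congr rfl fun a _ => Finset.sum_comm
    _ ≤ ∑ k, p k * (c ^ 2 * K) :=
        Finset.sum_le_sum fun k _ => mul_le_mul_of_nonneg_left (hpure k) (hp0 k)
    _ = c ^ 2 * K := by rw [← Finset.sum_mul, hp1, one_mul]

theorem minOutEntropy_mixture_le (hw0 : ∀ i, 0 ≤ w i) (hw1 : ∑ i, w i = 1)
    (hV : ∀ i, V i ∈ unitaryGroup m ℂ) (hρ : ρ.PosSemidef) (ht : ρ.trace = 1) :
    minOutEntropy (mixture w V) ≤ vnEntropy (mixture w V ρ) := by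
  refine csInf_le ⟨0, ?_⟩ ⟨ρ, hρ, ht, rfl⟩
  rintro _ ⟨r, hr, hr1, rfl⟩
  exact vnEntropy_nonneg (mixture_posSemidef hw0 hr) ((trace_mixture hw1 hV).trans hr1)

theorem le_minOutEntropy [Nonempty m] {Ψ : Matrix m m ℂ → Matrix m m ℂ} {b : ℝ}
    (h : ∀ ρ : Matrix m m ℂ, ρ.PosSemidef → ρ.trace = 1 → b ≤ vnEntropy (Ψ ρ)) :
    b ≤ minOutEntropy Ψ := by
  refine le_csInf ?_ ?_
  · obtain ⟨a⟩ := ‹Nonempty m›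
    refine ⟨_, vecMulVec (Pi.single a 1) (star (Pi.single a 1)),
      posSemidef_vecMulVec_self_star _, ?_, rfl⟩
    simp [trace_vecMulVec]
  · rintro _ ⟨ρ, hρ, ht, rfl⟩
    exact h ρ hρ ht

theorem le_minOutEntropy_mixture [Nonempty m] [Nonempty ι] {C : ℝ}
    (hV1 : ∀ i, V i ∈ unitaryGroup m ℂ) (hC : 0 ≤ C)
    (hV : ∀ x : m → ℂ, star x ⬝ᵥ x = 1 →
      ∑ i, ∑ j, ‖star (V i *ᵥ x) ⬝ᵥ (V j *ᵥ x)‖ ^ 2 ≤ Fintype.card ι + C) :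
    Real.log (Fintype.card ι) - C / Fintype.card ι ≤
      minOutEntropy (mixture (fun _ => 1 / (Fintype.card ι : ℝ)) V) := by
  have hd : (0 : ℝ) < Fintype.card ι := Nat.cast_pos.2 Fintype.card_pos
  refine le_minOutEntropy fun ρ hρ ht => ?_
  have hw1 : ∑ _ : ι, 1 / (Fintype.card ι : ℝ) = 1 := by simp [hd.ne']
  refine le_trans ?_ (neg_log_le_vnEntropy (mixture_posSemidef (fun _ => (one_div_pos.2 hd).le) hρ)
    ((trace_mixture hw1 hV1).trans ht) (by positivity) (sum_norm_sq_mixture_le hV hρ ht))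
  have h1 : (1 / (Fintype.card ι : ℝ)) ^ 2 * (Fintype.card ι + C) =
      (Fintype.card ι : ℝ)⁻¹ * (1 + C / Fintype.card ι) := by field_simp
  have h2 : 0 < 1 + C / Fintype.card ι := by positivity
  rw [h1, Real.log_mul (inv_ne_zero hd.ne') h2.ne', Real.log_inv]
  linarith [Real.log_le_sub_one_of_pos h2]

end Mixture

section MaximallyEntangled

variable {n d : ℕ}

/-- The (normalised) maximally entangled vector. -/
noncomputable def maxEntangled (n : ℕ) : Fin n × Fin n → ℂ :=
  fun p => if p.1 = p.2 then (((√n)⁻¹ : ℝ) : ℂ) else 0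

theorem star_maxEntangled_dotProduct_self (hn : 0 < n) :
    star (maxEntangled n) ⬝ᵥ maxEntangled n = 1 := by
  have hn' : (0 : ℝ) < n := Nat.cast_pos.2 hn
  have h : (((√n)⁻¹ : ℝ) : ℂ) * (((√n)⁻¹ : ℝ) : ℂ) = ((n : ℝ)⁻¹ : ℝ) := by
    rw [← Complex.ofReal_mul, ← mul_inv, Real.mul_self_sqrt hn'.le]
  simp only [dotProduct, Pi.star_apply, maxEntangled, Fintype.sum_prod_type, apply_ite star,
    star_zero, RCLike.star_def, Complex.conj_ofReal, ite_mul, mul_ite, zero_mul, mul_zero,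
    Finset.sum_ite_eq, Finset.mem_univ, if_true, h]
  rw [Finset.sum_const, Finset.card_univ, Fintype.card_fin, nsmul_eq_mul, ← Complex.ofReal_natCast,
    ← Complex.ofReal_mul, mul_inv_cancel₀ hn'.ne', Complex.ofReal_one]

open Kronecker in
theorem kronecker_mulVec_maxEntangled {A : Matrix (Fin n) (Fin n) ℂ}
    (hA : A ∈ unitaryGroup (Fin n) ℂ) :
    (A ⊗ₖ A.map star) *ᵥ maxEntangled n = maxEntangled n := by
  ext ⟨a, b⟩
  have h := congrFun (congrFun (mem_unitaryGroup_iff.1 hA) a) b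
  rw [mul_apply, one_apply] at h
  simp only [star_apply] at h
  simp only [mulVec, dotProduct, kroneckerMap_apply, map_apply, maxEntangled,
    Fintype.sum_prod_type, mul_ite, mul_zero, Finset.sum_ite_eq, Finset.mem_univ, if_true]
  rw [← Finset.sum_mul, h, ite_mul, one_mul, zero_mul]

open Kronecker in
theorem prodChannel_eq_mixture (w : Fin d → ℝ) (U : Fin d → Matrix (Fin n) (Fin n) ℂ) :
    prodChannel w U = mixture (fun p : Fin d × Fin d => w p.1 * w p.2)
      (fun p => U p.1 ⊗ₖ (U p.2).map star) := by
  funext ρ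
  rw [prodChannel, mixture, Fintype.sum_prod_type]

theorem conjRuChannel_eq_mixture (w : Fin d → ℝ) (U : Fin d → Matrix (Fin n) (Fin n) ℂ) :
    conjRuChannel w U = mixture w (fun i => (U i).map star) := by
  funext ρ
  refine Finset.sum_congr rfl fun i _ => ?_
  rw [show ((U i).map star)ᴴ = (U i)ᵀ from by ext; simp]

theorem minOutEntropy_prodChannel_le (hn : 0 < n) (hd : 0 < d)
    {U : Fin d → Matrix (Fin n) (Fin n) ℂ} (hU : ∀ i, U i ∈ unitaryGroup (Fin n) ℂ) :
    minOutEntropy (prodChannel (fun _ => 1 / (d : ℝ)) U) ≤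
      2 * Real.log d - Real.log d / d + 1 / d := by
  have hd' : (0 : ℝ) < d := Nat.cast_pos.2 hd
  have hx := star_maxEntangled_dotProduct_self hn
  rw [prodChannel_eq_mixture]
  have hw0 (p : Fin d × Fin d) : 0 ≤ 1 / (d : ℝ) * (1 / (d : ℝ)) := by positivity
  have hw1 : ∑ _ : Fin d × Fin d, 1 / (d : ℝ) * (1 / (d : ℝ)) = 1 := by
    simp
    field_simp
  have hV (p : Fin d × Fin d) :=
    kronecker_mem_unitary (hU p.1) (map_star_mem_unitaryGroup_iff.2 (hU p.2))
  have hρ := posSemidef_vecMulVec_self_star (maxEntangled n)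
  have ht : (vecMulVec (maxEntangled n) (star (maxEntangled n))).trace = 1 := by
    rw [trace_vecMulVec, dotProduct_comm, hx]
  refine (minOutEntropy_mixture_le hw0 hw1 hV hρ ht).trans ?_
  refine vnEntropy_le (mixture_posSemidef hw0 hρ) ((trace_mixture hw1 hV).trans ht) hd
    ((rank_mixture_vecMulVec_le _).trans_eq (by simp)) hx ?_
  rw [re_dotProduct_mixture_vecMulVec, Fintype.sum_prod_type]
  calc 1 / (d : ℝ) = ∑ _ : Fin d, 1 / (d : ℝ) * (1 / (d : ℝ)) := by
        simp [hd'.ne']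
    _ ≤ _ := Finset.sum_le_sum fun i _ => ?_
  refine le_trans (le_of_eq ?_) (Finset.single_le_sum (fun j _ => mul_nonneg (hw0 (i, j))
    (sq_nonneg _)) (Finset.mem_univ i))
  simp only
  rw [kronecker_mulVec_maxEntangled (hU i), hx, norm_one, one_pow, mul_one]

end MaximallyEntangled

section Overlaps

theorem sum_range_sum_range_eq (g : ℕ → ℕ → ℝ) (hdiag : ∀ i, g i i = 1)
    (hsymm : ∀ i j, g i j = g j i) (d : ℕ) :
    ∑ i ∈ Finset.range d, ∑ j ∈ Finset.range d, g i j =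
      d + 2 * ∑ j ∈ Finset.range d, ∑ i ∈ Finset.range j, g i j := by
  induction d with
  | zero => simp
  | succ d ih =>
    simp only [Finset.sum_range_succ, Finset.sum_add_distrib, ih, hdiag, hsymm d]
    push_cast
    ring

theorem sum_sum_norm_inner_sq {E : Type*} [NormedAddCommGroup E] [InnerProductSpace ℂ E]
    (v : ℕ → E) (hv : ∀ i, ‖v i‖ = 1) (d : ℕ) :
    ∑ i : Fin d, ∑ j : Fin d, ‖inner ℂ (v i) (v j)‖ ^ 2 =
      d + 2 * upperNormSq d fun i j => inner ℂ (v i) (v j) := by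
  rw [upperNormSq, ← sum_range_sum_range_eq (fun i j => ‖inner ℂ (v i) (v j)‖ ^ 2),
    Finset.sum_range]
  · exact Finset.sum_congr rfl fun i _ => (Finset.sum_range fun j => ‖inner ℂ (v i) (v j)‖ ^ 2).symm
  · intro i
    rw [inner_self_eq_norm_sq_to_K, hv]
    simp
  · intro i j
    rw [norm_inner_symm]

/-- Matrix form of the existence of unitaries with small overlaps. -/
theorem exists_unitaryGroup_overlaps_le :
    ∃ C : ℝ, 0 ≤ C ∧ ∀ d : ℕ, ∃ n : ℕ, 0 < n ∧ ∃ U : Fin d → Matrix (Fin n) (Fin n) ℂ,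
      (∀ i, U i ∈ unitaryGroup (Fin n) ℂ) ∧ ∀ x : Fin n → ℂ, star x ⬝ᵥ x = 1 →
        ∑ i, ∑ j, ‖star (U i *ᵥ x) ⬝ᵥ (U j *ᵥ x)‖ ^ 2 ≤ d + C := by
  obtain ⟨C, hC⟩ := exists_unitaries_upperNormSq_le
  refine ⟨2 * max C 0, by positivity, fun d => ?_⟩
  obtain ⟨n, hn, U, hU⟩ := hC d
  let M : ℕ → Matrix (Fin n) (Fin n) ℂ := fun i =>
    (toEuclideanCLM (n := Fin n) (𝕜 := ℂ)).symm
      (Unitary.linearIsometryEquiv.symm (U i) : EuclideanSpace ℂ (Fin n) →L[ℂ] _)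
  have hM (i : ℕ) (x : EuclideanSpace ℂ (Fin n)) : WithLp.toLp 2 (M i *ᵥ x.ofLp) = U i x := by
    rw [← toEuclideanCLM_toLp, StarAlgEquiv.apply_symm_apply]
    rfl
  refine ⟨n, hn, fun i => M i, fun i =>
    Unitary.map_mem (toEuclideanCLM (n := Fin n) (𝕜 := ℂ)).symm
      (Unitary.linearIsometryEquiv.symm (U i)).2, fun x hx => ?_⟩
  set ψ : EuclideanSpace ℂ (Fin n) := WithLp.toLp 2 x with hψ
  have hinner (y z : Fin n → ℂ) :
      star y ⬝ᵥ z = inner ℂ (WithLp.toLp 2 y) (WithLp.toLp 2 z : EuclideanSpace ℂ (Fin n)) := by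
    rw [EuclideanSpace.inner_toLp_toLp, dotProduct_comm]
  have hψ1 : ‖ψ‖ = 1 := by
    have h := inner_self_eq_norm_sq (𝕜 := ℂ) ψ
    rw [hψ, ← hinner, hx, RCLike.one_re] at h
    exact (pow_eq_one_iff_of_nonneg (norm_nonneg ψ) two_ne_zero).1 h.symm
  have h := sum_sum_norm_inner_sq (fun i => U i ψ) (fun i => by simp [hψ1]) d
  have hle := (hU ψ hψ1).trans (le_max_left C 0)
  simp only [hinner, ← hM] at h hle ⊢
  linarith

theorem map_star_mulVec {n : ℕ} (A : Matrix (Fin n) (Fin n) ℂ) (x : Fin n → ℂ) :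
    A.map star *ᵥ x = star (A *ᵥ star x) := by
  ext a
  simp [mulVec, dotProduct]

end Overlaps

end RandomUnitary

/-- There exist a random unitary channel `Φ` for which additivity of the minimal output
von Neumann entropy fails for `Φ ⊗ Φ̄`. -/
theorem additivity_of_minimal_output_entropy_fails :
    ∃ (n d : ℕ) (w : Fin d → ℝ) (U : Fin d → Matrix (Fin n) (Fin n) ℂ),
      0 < n ∧ 0 < d ∧ (∀ i, 0 ≤ w i) ∧ ∑ i, w i = 1 ∧
      (∀ i, U i ∈ Matrix.unitaryGroup (Fin n) ℂ) ∧
      minOutEntropy (prodChannel w U) <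
        minOutEntropy (ruChannel w U) + minOutEntropy (conjRuChannel w U) := by
  obtain ⟨C, hC0, hC⟩ := RandomUnitary.exists_unitaryGroup_overlaps_le
  obtain ⟨d, hd, hlog⟩ : ∃ d : ℕ, 0 < d ∧ 2 * C + 1 < Real.log d :=
    ((Filter.eventually_gt_atTop 0).and ((Real.tendsto_log_atTop.comp
      tendsto_natCast_atTop_atTop).eventually_gt_atTop (2 * C + 1))).exists
  obtain ⟨n, hn, U, hU, hoverlap⟩ := hC d
  have hd' : (0 : ℝ) < d := Nat.cast_pos.2 hd
  have : Nonempty (Fin n) := ⟨⟨0, hn⟩⟩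
  have : Nonempty (Fin d) := ⟨⟨0, hd⟩⟩
  refine ⟨n, d, fun _ => 1 / (d : ℝ), U, hn, hd, fun _ => by positivity, by simp [hd'.ne'], hU, ?_⟩
  have hprod := RandomUnitary.minOutEntropy_prodChannel_le hn hd hU
  have h1 := RandomUnitary.le_minOutEntropy_mixture hU hC0 (by simpa using hoverlap)
  have h2 := RandomUnitary.le_minOutEntropy_mixture (V := fun i => (U i).map star)
    (fun i => map_star_mem_unitaryGroup_iff.2 (hU i)) hC0 fun x hx => by
      have hx' : star (star x) ⬝ᵥ star x = 1 := by
        rw [star_dotProduct_star, dotProduct_comm, hx, star_one]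
      refine le_trans (le_of_eq ?_) ((hoverlap (star x) hx').trans_eq (by simp))
      refine Finset.sum_congr rfl fun i _ => Finset.sum_congr rfl fun j _ => ?_
      rw [RandomUnitary.map_star_mulVec, RandomUnitary.map_star_mulVec, star_dotProduct_star,
        norm_star, dotProduct_comm]
  rw [← RandomUnitary.conjRuChannel_eq_mixture] at h2
  rw [Fintype.card_fin] at h1 h2
  change Real.log d - C / d ≤ minOutEntropy (ruChannel (fun _ => 1 / (d : ℝ)) U) at h1
  have h3 : (2 * C + 1) / d < Real.log d / d := div_lt_div_of_pos_right hlog hd'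
  have h4 : (2 * C + 1) / d = C / d + C / d + 1 / d := by ring
  linarith
end

section
/- For every n ≥ 1, every d ≥ 2, every choice of weights w_1,…,w_d ≥ 0 with ∑_{i=1}^d w_i = 1, and every choice of unitary n×n matrices U_1,…,U_d, the resulting random unitary channel Φ satisfies S_min(Φ ⊗ Φ̄) ≤ 2 log d − (log d)/d. -/
open scoped BigOperators ComplexOrder
open Matrix

section EnsembleEntropy

variable {E κ ι : Type*} [NormedAddCommGroup E] [InnerProductSpace ℂ E] [Fintype κ] [Fintype ι]

/-- If `∑ a, p a |v a⟩⟨v a|` is diagonal in the orthonormal basis `b` with eigenvalues `l`, then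
`p a ⟨v a, ρ⁻¹ v a⟩ ≤ 1`, where the inverse is a pseudo-inverse since `x / 0 = 0`. -/
theorem ensemble_weight_mul_sum_div_le_one (b : OrthonormalBasis κ ℂ E) (l : κ → ℝ) (p : ι → ℝ)
    (v : ι → E) (hp : ∀ a, 0 ≤ p a)
    (h : ∀ k x, ∑ a, (p a : ℂ) * (inner ℂ x (v a) * inner ℂ (v a) (b k)) =
      (l k : ℂ) * inner ℂ x (b k)) (a : ι) :
    p a * ∑ k, ‖inner ℂ (b k) (v a)‖ ^ 2 / l k ≤ 1 := by
  set S : ℝ := ∑ k, ‖inner ℂ (b k) (v a)‖ ^ 2 / l k with hS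
  set γ : κ → ℂ := fun k => inner ℂ (b k) (v a) / (l k : ℂ) with hγ
  set c : E := ∑ k, γ k • b k with hc
  have hbc (k : κ) : inner ℂ c (b k) = (starRingEnd ℂ) (γ k) := by
    rw [← inner_conj_symm, hc, b.orthonormal.inner_right_fintype]
  have hvc : inner ℂ (v a) c = (S : ℂ) := by
    rw [hc, inner_sum, hS, Complex.ofReal_sum]
    refine Finset.sum_congr rfl fun k _ => ?_
    rw [inner_smul_right, ← inner_conj_symm (v a) (b k), hγ, div_mul_eq_mul_div,
      Complex.mul_conj']
    push_cast
    rfl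
  have hquad : ∑ a', (p a' : ℂ) * (inner ℂ c (v a') * inner ℂ (v a') c) = (S : ℂ) := by
    have hexp (a' : ι) : inner ℂ (v a') c = ∑ k, γ k * inner ℂ (v a') (b k) := by
      rw [hc, inner_sum]
      simp only [inner_smul_right]
    calc ∑ a', (p a' : ℂ) * (inner ℂ c (v a') * inner ℂ (v a') c)
        = ∑ k, γ k * ∑ a', (p a' : ℂ) * (inner ℂ c (v a') * inner ℂ (v a') (b k)) := by
          simp only [hexp, Finset.mul_sum]
          rw [Finset.sum_comm]
          exact Finset.sum_congr rfl fun k _ => Finset.sum_congr rfl fun a' _ => by ring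
      _ = (S : ℂ) := by
          rw [hS, Complex.ofReal_sum]
          refine Finset.sum_congr rfl fun k _ => ?_
          rw [h, hbc, hγ, map_div₀, Complex.conj_ofReal]
          push_cast
          rw [← Complex.mul_conj']
          by_cases hl : (l k : ℂ) = 0
          · simp [hl]
          · field_simp
  have hquad' : ∑ a', p a' * ‖inner ℂ (v a') c‖ ^ 2 = S := by
    have : ((∑ a', p a' * ‖inner ℂ (v a') c‖ ^ 2 : ℝ) : ℂ) = (S : ℂ) := by
      rw [← hquad]
      push_cast
      refine Finset.sum_congr rfl fun a' _ => ?_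
      rw [← inner_conj_symm c (v a'), Complex.conj_mul']
    exact_mod_cast this
  have hle : p a * S ^ 2 ≤ S := by
    have := Finset.single_le_sum (f := fun a' => p a' * ‖inner ℂ (v a') c‖ ^ 2)
      (fun a' _ => mul_nonneg (hp a') (sq_nonneg _)) (Finset.mem_univ a)
    rw [hquad'] at this
    simpa [hvc] using this
  rcases le_or_gt S 0 with hS0 | hS0
  · exact (mul_nonpos_of_nonneg_of_nonpos (hp a) hS0).trans zero_le_one
  · nlinarith

/-- The Shannon-type upper bound on the entropy of the ensemble average `∑ a, p a |v a⟩⟨v a|`,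
combined with Gibbs' inequality with respect to a subnormalized `q`. -/
theorem neg_sum_mul_log_le_of_ensemble (b : OrthonormalBasis κ ℂ E) (l : κ → ℝ) (p q : ι → ℝ)
    (v : ι → E) (hp : ∀ a, 0 ≤ p a) (hp1 : ∑ a, p a = 1) (hq : ∀ a, 0 < q a)
    (hq1 : ∑ a, q a ≤ 1) (hv : ∀ a, ‖v a‖ = 1)
    (h : ∀ k x, ∑ a, (p a : ℂ) * (inner ℂ x (v a) * inner ℂ (v a) (b k)) =
      (l k : ℂ) * inner ℂ x (b k)) :
    -∑ k, l k * Real.log (l k) ≤ -∑ a, p a * Real.log (q a) := by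
  set D : κ → ι → ℝ := fun k a => ‖inner ℂ (b k) (v a)‖ ^ 2 with hD
  have hD0 (k : κ) (a : ι) : 0 ≤ D k a := sq_nonneg _
  have hD1 (a : ι) : ∑ k, D k a = 1 := by
    rw [hD, b.sum_sq_norm_inner_right, hv, one_pow]
  have hl (k : κ) : ∑ a, p a * D k a = l k := by
    have := h k (b k)
    rw [inner_self_eq_norm_sq_to_K, b.orthonormal.1 k] at this
    have h' : ((∑ a, p a * D k a : ℝ) : ℂ) = (l k : ℂ) := by
      rw [← mul_one (l k : ℂ)]
      convert this using 1
      · push_cast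
        refine Finset.sum_congr rfl fun a _ => ?_
        rw [← inner_conj_symm (v a) (b k), Complex.mul_conj', hD]
        push_cast
        rfl
      · simp
    exact_mod_cast h'
  have hterm (k : κ) (a : ι) : p a * D k a * (Real.log (q a) - Real.log (l k)) ≤
      q a * (p a * (D k a / l k)) - p a * D k a := by
    have hpD (a' : ι) : 0 ≤ p a' * D k a' := mul_nonneg (hp a') (hD0 k a')
    have hlk : 0 ≤ l k := hl k ▸ Finset.sum_nonneg fun a' _ => hpD a'
    rcases hlk.eq_or_lt with h0 | h0
    · have hz : p a * D k a = 0 :=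
        (Finset.sum_eq_zero_iff_of_nonneg fun a' _ => hpD a').1 ((hl k).trans h0.symm) a
          (Finset.mem_univ a)
      simp [hz, ← h0]
    · rw [← Real.log_div (hq a).ne' h0.ne']
      calc p a * D k a * Real.log (q a / l k) ≤ p a * D k a * (q a / l k - 1) :=
            mul_le_mul_of_nonneg_left
              (Real.log_le_sub_one_of_pos (div_pos (hq a) h0)) (hpD a)
        _ = _ := by ring
  have hsum : ∑ a, ∑ k, p a * D k a * (Real.log (q a) - Real.log (l k)) ≤
      ∑ a, (q a - p a) := by
    refine Finset.sum_le_sum fun a _ => ?_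
    calc ∑ k, p a * D k a * (Real.log (q a) - Real.log (l k))
        ≤ ∑ k, (q a * (p a * (D k a / l k)) - p a * D k a) :=
          Finset.sum_le_sum fun k _ => hterm k a
      _ = q a * (p a * ∑ k, D k a / l k) - p a := by
          rw [Finset.sum_sub_distrib, ← Finset.mul_sum, ← Finset.mul_sum, ← Finset.mul_sum,
            hD1, mul_one]
      _ ≤ q a - p a := by
          have := ensemble_weight_mul_sum_div_le_one b l p v hp h a
          have := mul_le_mul_of_nonneg_left this (hq a).le
          linarith
  have hsplit : ∑ a, ∑ k, p a * D k a * (Real.log (q a) - Real.log (l k)) =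
      ∑ a, p a * Real.log (q a) - ∑ k, l k * Real.log (l k) := by
    simp only [mul_sub, Finset.sum_sub_distrib]
    congr 1
    · refine Finset.sum_congr rfl fun a _ => ?_
      rw [← Finset.sum_mul, ← Finset.mul_sum, hD1, mul_one]
    · rw [Finset.sum_comm]
      refine Finset.sum_congr rfl fun k _ => ?_
      rw [← Finset.sum_mul, hl]
  rw [hsplit, Finset.sum_sub_distrib, hp1] at hsum
  linarith

end EnsembleEntropy

theorem vnEntropy_ensemble_le {m ι : Type*} [Fintype m] [DecidableEq m] [Fintype ι]
    (p q : ι → ℝ) (v : ι → m → ℂ) (hp : ∀ a, 0 ≤ p a) (hp1 : ∑ a, p a = 1) (hq : ∀ a, 0 < q a)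
    (hq1 : ∑ a, q a ≤ 1) (hv : ∀ a, star (v a) ⬝ᵥ v a = 1) :
    vnEntropy (∑ a, (p a : ℂ) • vecMulVec (v a) (star (v a))) ≤
      -∑ a, p a * Real.log (q a) := by
  have hH : (∑ a, (p a : ℂ) • vecMulVec (v a) (star (v a))).IsHermitian := by
    simp [Matrix.IsHermitian, conjTranspose_sum, conjTranspose_smul, conjTranspose_vecMulVec]
  rw [vnEntropy, dif_pos hH]
  refine neg_sum_mul_log_le_of_ensemble hH.eigenvectorBasis hH.eigenvalues p q
    (fun a => WithLp.toLp 2 (v a)) hp hp1 hq hq1 (fun a => ?_) (fun k x => ?_)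
  · have := hv a
    rw [dotProduct_comm, ← EuclideanSpace.inner_toLp_toLp, inner_self_eq_norm_sq_to_K] at this
    refine (pow_eq_one_iff_of_nonneg (norm_nonneg _) two_ne_zero).1 (Complex.ofReal_injective ?_)
    rw [Complex.ofReal_pow, Complex.ofReal_one]
    exact this
  · have := congrArg (star x.ofLp ⬝ᵥ ·) (hH.mulVec_eigenvectorBasis k)
    simp only [sum_mulVec, smul_mulVec, vecMulVec_mulVec, dotProduct_sum, dotProduct_smul,
      smul_eq_mul, MulOpposite.smul_eq_mul_unop, MulOpposite.unop_op, Complex.real_smul] at this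
    simp only [EuclideanSpace.inner_eq_star_dotProduct]
    simp only [dotProduct_comm _ (star _)]
    exact this

theorem kronecker_mulVec_vec_one {n : Type*} [Fintype n] [DecidableEq n] (A B : Matrix n n ℂ) :
    kroneckerMap (· * ·) A (B.map star) *ᵥ vec 1 = vec (B.map star * Aᵀ) := by
  rw [kronecker_mulVec_vec, Matrix.mul_one]

theorem star_vec_map_star_mul_transpose_dotProduct_self {n : Type*} [Fintype n] [DecidableEq n]
    {A B : Matrix n n ℂ} (hA : A ∈ unitaryGroup n ℂ) (hB : B ∈ unitaryGroup n ℂ) :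
    star (vec (B.map star * Aᵀ)) ⬝ᵥ vec (B.map star * Aᵀ) = (Fintype.card n : ℂ) := by
  have hB' : (B.map star)ᴴ * B.map star = 1 := by
    have := congrArg transpose (mem_unitaryGroup_iff'.1 hB)
    rw [star_eq_conjTranspose, transpose_mul, transpose_one] at this
    rw [← this]
    congr 1
    ext i j
    simp
  have hA' : Aᵀᴴ * Aᵀ = 1 := by
    have := congrArg transpose (mem_unitaryGroup_iff.1 hA)
    rw [star_eq_conjTranspose, transpose_mul, transpose_one] at this
    rw [← this]
    rfl
  rw [star_vec_dotProduct_vec, conjTranspose_mul, Matrix.mul_assoc, ← Matrix.mul_assoc _ _ Aᵀ,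
    hB', Matrix.one_mul, hA', trace_one]

theorem map_star_mul_transpose_self {n : Type*} [Fintype n] [DecidableEq n]
    {A : Matrix n n ℂ} (hA : A ∈ unitaryGroup n ℂ) : A.map star * Aᵀ = 1 := by
  have := congrArg transpose (mem_unitaryGroup_iff.1 hA)
  rw [star_eq_conjTranspose, transpose_mul, transpose_one] at this
  rw [← this]
  rfl

theorem sum_option_offDiag {ι M : Type*} [Fintype ι] [AddCommMonoid M]
    (f : ι → ι → M) (g : Option {x : ι × ι // x ∈ (Finset.univ : Finset ι).offDiag} → M)
    (hnone : g none = ∑ i, f i i) (hsome : ∀ x, g (some x) = f x.1.1 x.1.2) :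
    ∑ a, g a = ∑ i, ∑ j, f i j := by
  classical
  rw [Fintype.sum_option, hnone, ← Finset.sum_product', ← Finset.diag_union_offDiag,
    Finset.sum_union (Finset.disjoint_diag_offDiag _), Finset.sum_diag]
  simp only [hsome]
  rw [Finset.sum_coe_sort Finset.univ.offDiag fun x : ι × ι => f x.1 x.2]

/-- The normalized vectors `(U i ⊗ conj (U j)) Ω`, where `Ω` is the maximally entangled vector. -/
noncomputable def entangledOutput {n d : ℕ} (U : Fin d → Matrix (Fin n) (Fin n) ℂ) (i j : Fin d) :
    Fin n × Fin n → ℂ :=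
  ((√n : ℝ) : ℂ)⁻¹ • vec ((U j).map star * (U i)ᵀ)

theorem star_entangledOutput_dotProduct_self {n d : ℕ} (hn : 1 ≤ n)
    (U : Fin d → Matrix (Fin n) (Fin n) ℂ) (hU : ∀ i, U i ∈ unitaryGroup (Fin n) ℂ)
    (i j : Fin d) : star (entangledOutput U i j) ⬝ᵥ entangledOutput U i j = 1 := by
  have hn0 : (n : ℂ) ≠ 0 := by exact_mod_cast (show n ≠ 0 by omega)
  have hs : ((√n : ℝ) : ℂ) * ((√n : ℝ) : ℂ) = n := by
    rw [← Complex.ofReal_mul, Real.mul_self_sqrt n.cast_nonneg, Complex.ofReal_natCast]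
  rw [entangledOutput, star_smul, smul_dotProduct, dotProduct_smul,
    star_vec_map_star_mul_transpose_dotProduct_self (hU i) (hU j), Fintype.card_fin, star_inv₀]
  simp only [Complex.star_def, Complex.conj_ofReal, smul_eq_mul]
  rw [← mul_assoc, ← mul_inv, hs, inv_mul_cancel₀ hn0]

theorem prodChannel_entangled {n d : ℕ} (w : Fin d → ℝ) (U : Fin d → Matrix (Fin n) (Fin n) ℂ) :
    prodChannel w U (vecMulVec (((√n : ℝ) : ℂ)⁻¹ • vec (1 : Matrix (Fin n) (Fin n) ℂ))
      (star (((√n : ℝ) : ℂ)⁻¹ • vec (1 : Matrix (Fin n) (Fin n) ℂ)))) =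
      ∑ i, ∑ j, ((w i * w j : ℝ) : ℂ) •
        vecMulVec (entangledOutput U i j) (star (entangledOutput U i j)) := by
  refine Finset.sum_congr rfl fun i _ => Finset.sum_congr rfl fun j _ => ?_
  rw [mul_vecMulVec, vecMulVec_mul, ← star_mulVec, mulVec_smul, kronecker_mulVec_vec_one,
    entangledOutput]

theorem vnEntropy_prodChannel_entangled_le {n d : ℕ} (hn : 1 ≤ n) (hd : 2 ≤ d)
    (w : Fin d → ℝ) (hw0 : ∀ i, 0 ≤ w i) (hw1 : ∑ i, w i = 1)
    (U : Fin d → Matrix (Fin n) (Fin n) ℂ) (hU : ∀ i, U i ∈ unitaryGroup (Fin n) ℂ) :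
    vnEntropy (∑ i, ∑ j, ((w i * w j : ℝ) : ℂ) •
      vecMulVec (entangledOutput U i j) (star (entangledOutput U i j))) ≤
      2 * Real.log d - Real.log d / d := by
  have hd0 : (0 : ℝ) < d := by exact_mod_cast (show 0 < d by omega)
  let i₀ : Fin d := ⟨0, by omega⟩
  let p : Option {x : Fin d × Fin d // x ∈ (Finset.univ : Finset (Fin d)).offDiag} → ℝ :=
    fun a => a.elim (∑ i, w i * w i) fun x => w x.1.1 * w x.1.2
  let q : Option {x : Fin d × Fin d // x ∈ (Finset.univ : Finset (Fin d)).offDiag} → ℝ :=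
    fun a => a.elim (1 / d) fun _ => 1 / d ^ 2
  let v : Option {x : Fin d × Fin d // x ∈ (Finset.univ : Finset (Fin d)).offDiag} →
      Fin n × Fin n → ℂ :=
    fun a => a.elim (entangledOutput U i₀ i₀) fun x => entangledOutput U x.1.1 x.1.2
  have hww : ∑ i, ∑ j, w i * w j = 1 := by
    rw [← Finset.sum_mul_sum, hw1, one_mul]
  have hdiag (i : Fin d) : entangledOutput U i i = entangledOutput U i₀ i₀ := by
    rw [entangledOutput, entangledOutput, map_star_mul_transpose_self (hU i),
      map_star_mul_transpose_self (hU i₀)]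
  have hp1 : ∑ a, p a = 1 :=
    (sum_option_offDiag (fun i j => w i * w j) p rfl fun _ => rfl).trans hww
  have hq1 : ∑ a, q a = 1 := by
    rw [sum_option_offDiag (fun _ _ : Fin d => (1 : ℝ) / d ^ 2) q ?_ fun _ => rfl]
    · simp only [Finset.sum_const, Finset.card_univ, Fintype.card_fin, nsmul_eq_mul]
      field_simp
    · simp only [q, Option.elim, Finset.sum_const, Finset.card_univ, Fintype.card_fin,
        nsmul_eq_mul]
      field_simp
  have hρ : ∑ i, ∑ j, ((w i * w j : ℝ) : ℂ) •
      vecMulVec (entangledOutput U i j) (star (entangledOutput U i j)) =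
      ∑ a, (p a : ℂ) • vecMulVec (v a) (star (v a)) := by
    refine (sum_option_offDiag _ _ ?_ fun _ => rfl).symm
    simp only [p, v, Option.elim, hdiag, Complex.ofReal_sum, Finset.sum_smul]
  have hs : 1 / d ≤ ∑ i, w i * w i := by
    have := sq_sum_le_card_mul_sum_sq (s := Finset.univ) (f := w)
    rw [hw1, Finset.card_univ, Fintype.card_fin] at this
    rw [div_le_iff₀' hd0]
    simpa [sq] using this
  have hlog : 0 ≤ Real.log d := Real.log_natCast_nonneg d
  have hsum : -∑ a, p a * Real.log (q a) = 2 * Real.log d - (∑ i, w i * w i) * Real.log d := by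
    have hterm (a) : p a * Real.log (q a) =
        p a * (-(2 * Real.log d)) + a.elim ((∑ i, w i * w i) * Real.log d) fun _ => 0 := by
      cases a
      · simp [p, q]
        ring
      · simp [p, q]
    simp only [hterm]
    rw [Finset.sum_add_distrib, ← Finset.sum_mul, hp1, Fintype.sum_option]
    simp
    ring
  calc _ ≤ -∑ a, p a * Real.log (q a) := by
        rw [hρ]
        refine vnEntropy_ensemble_le p q v (fun a => ?_) hp1 (fun a => ?_) hq1.le fun a => ?_
        · cases a
          · exact Finset.sum_nonneg fun i _ => mul_self_nonneg (w i)
          · exact mul_nonneg (hw0 _) (hw0 _)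
        · cases a <;> simp only [q, Option.elim] <;> positivity
        · cases a <;> exact star_entangledOutput_dotProduct_self hn U hU _ _
    _ ≤ 2 * Real.log d - Real.log d / d := by
        rw [hsum]
        have := mul_le_mul_of_nonneg_right hs hlog
        rw [one_div_mul_eq_div] at this
        linarith

/-- For every random unitary channel `Φ`, the minimal output entropy of `Φ ⊗ Φ̄` is at most
`2 log d − (log d)/d`. -/
theorem minOutEntropy_prod_le {n d : ℕ} (hn : 1 ≤ n) (hd : 2 ≤ d)
    (w : Fin d → ℝ) (hw0 : ∀ i, 0 ≤ w i) (hw1 : ∑ i, w i = 1)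
    (U : Fin d → Matrix (Fin n) (Fin n) ℂ) (hU : ∀ i, U i ∈ Matrix.unitaryGroup (Fin n) ℂ) :
    minOutEntropy (prodChannel w U) ≤ 2 * Real.log d - Real.log d / d := by
  have hmem : ∃ ρ : Matrix (Fin n × Fin n) (Fin n × Fin n) ℂ, ρ.PosSemidef ∧ ρ.trace = 1 ∧
      vnEntropy (prodChannel w U ρ) ≤ 2 * Real.log d - Real.log d / d := by
    refine ⟨_, posSemidef_vecMulVec_self_star
      (((√n : ℝ) : ℂ)⁻¹ • vec (1 : Matrix (Fin n) (Fin n) ℂ)), ?_, ?_⟩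
    · have := star_entangledOutput_dotProduct_self hn
        (fun _ : Fin 1 => (1 : Matrix (Fin n) (Fin n) ℂ)) (fun _ => one_mem _) 0 0
      rw [entangledOutput, map_star_mul_transpose_self (one_mem _)] at this
      rw [trace_vecMulVec, dotProduct_comm, this]
    · rw [prodChannel_entangled]
      exact vnEntropy_prodChannel_entangled_le hn hd w hw0 hw1 U hU
  obtain ⟨ρ, hρ, htr, hle⟩ := hmem
  by_cases hb : BddBelow {x : ℝ | ∃ ρ : Matrix (Fin n × Fin n) (Fin n × Fin n) ℂ,
      ρ.PosSemidef ∧ ρ.trace = 1 ∧ x = vnEntropy (prodChannel w U ρ)}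
  · exact (csInf_le hb ⟨ρ, hρ, htr, rfl⟩).trans hle
  · rw [minOutEntropy, Real.sInf_of_not_bddBelow hb]
    have hlog : 0 ≤ Real.log d := Real.log_natCast_nonneg d
    have := div_le_self hlog (show (1 : ℝ) ≤ d by exact_mod_cast (show 1 ≤ d by omega))
    linarith
end

section
/- There exists h_min < ∞ such that for all h > h_min and all integers d ≥ 2 satisfying d·log d ≥ h, there is N < ∞ such that for all n ≥ N there exist weights w_1,…,w_d ≥ 0 with ∑_{i=1}^d w_i = 1 and unitary n×n matrices U_1,…,U_d whose random unitary channel Φ satisfies S_min(Φ) > log d − h/d. -/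
open scoped BigOperators ComplexOrder
open Matrix

section Haar

open MeasureTheory

variable {E : Type*} [NormedAddCommGroup E] [InnerProductSpace ℂ E]

/-- The unitary group of a finite-dimensional Hilbert space is compact. -/
theorem compactSpace_unitary_clm [FiniteDimensional ℂ E] [CompleteSpace E] :
    CompactSpace (unitary (E →L[ℂ] E)) := by
  refine isCompact_iff_compactSpace (s := (unitary (E →L[ℂ] E) : Set (E →L[ℂ] E))).1 ?_
  have : ProperSpace (E →L[ℂ] E) := FiniteDimensional.proper ℂ _
  refine (isCompact_closedBall (0 : E →L[ℂ] E) 1).of_isClosed_subset isClosed_unitary ?_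
  intro U hU
  rw [mem_closedBall_zero_iff]
  refine ContinuousLinearMap.opNorm_le_bound _ zero_le_one fun x => ?_
  rw [one_mul]
  exact le_of_eq ((Unitary.linearIsometryEquiv (𝕜 := ℂ) (H := E) ⟨U, hU⟩).norm_map x)

theorem norm_unitary_clm_apply [CompleteSpace E] (U : unitary (E →L[ℂ] E)) (x : E) :
    ‖(U : E →L[ℂ] E) x‖ = ‖x‖ :=
  (Unitary.linearIsometryEquiv (𝕜 := ℂ) (H := E) U).norm_map x

/-- The unitary group acts transitively on spheres. -/
theorem exists_unitary_clm_apply_eq [FiniteDimensional ℂ E] [CompleteSpace E]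
    {x y : E} (h : ‖x‖ = ‖y‖) :
    ∃ V : unitary (E →L[ℂ] E), (V : E →L[ℂ] E) x = y := by
  rcases eq_or_ne x 0 with rfl | hx
  · refine ⟨1, ?_⟩
    have : y = 0 := by simpa using h.symm
    simp [this]
  let L₀ : (ℂ ∙ x) →ₗ[ℂ] E :=
    (LinearMap.toSpanSingleton ℂ E y) ∘ₗ
      (LinearEquiv.toSpanNonzeroSingleton ℂ E x hx).symm.toLinearMap
  let L : (ℂ ∙ x) →ₗᵢ[ℂ] E :=
    { L₀ with
      norm_map' := by
        intro z
        obtain ⟨c, rfl⟩ := (LinearEquiv.toSpanNonzeroSingleton ℂ E x hx).surjective z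
        have h1 : L₀ (LinearEquiv.toSpanNonzeroSingleton ℂ E x hx c) = c • y := by
          simp only [L₀, LinearMap.comp_apply, LinearEquiv.coe_coe, LinearEquiv.symm_apply_apply]
          simp
        rw [h1, norm_smul, ← h, ← norm_smul]
        rfl }
  let e : E ≃ₗᵢ[ℂ] E := L.extend.toLinearIsometryEquiv rfl
  refine ⟨Unitary.linearIsometryEquiv.symm e, ?_⟩
  change L.extend x = y
  have hmem : x ∈ (ℂ ∙ x) := Submodule.mem_span_singleton_self x
  have h1 := L.extend_apply ⟨x, hmem⟩
  refine h1.trans ?_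
  change L₀ ⟨x, hmem⟩ = y
  have h2 : (LinearEquiv.toSpanNonzeroSingleton ℂ E x hx).symm ⟨x, hmem⟩ = 1 := by
    rw [LinearEquiv.symm_apply_eq]
    ext
    simp [LinearEquiv.toSpanNonzeroSingleton_apply]
  simp only [L₀, LinearMap.comp_apply, LinearEquiv.coe_coe, h2]
  simp

theorem sum_prod_exp_sign {n : ℕ} (t : Fin n → ℝ) :
    ∑ ε : Fin n → Bool, Real.exp (∑ k, (if ε k then t k else -t k))
      = 2 ^ n * ∏ k, Real.cosh (t k) := by
  have h1 : ∀ k, ∑ b : Bool, Real.exp (if b then t k else -t k) = 2 * Real.cosh (t k) := by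
    intro k
    rw [Real.cosh_eq]
    simp
    ring
  have h2 := Finset.prod_univ_sum (fun _ : Fin n => (Finset.univ : Finset Bool))
    (fun k b => Real.exp (if b then t k else -t k))
  simp only [h1, Finset.prod_mul_distrib, Finset.prod_const, Finset.card_univ, Fintype.card_fin,
    Fintype.piFinset_univ] at h2
  rw [h2]
  exact Finset.sum_congr rfl fun ε _ => Real.exp_sum _ _

/-- Averaging `exp (re ⟪y, u⟫)` over sign changes of a vector `y` that is flat in an orthonormal
basis gives a subgaussian bound. -/
theorem sum_exp_re_inner_flat_le {n : ℕ} (b : OrthonormalBasis (Fin n) ℂ E) (r : ℝ) (u : E) :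
    ∑ ε : Fin n → Bool, Real.exp
      (RCLike.re (inner ℂ (∑ k, ((if ε k then r else -r : ℝ) : ℂ) • b k) u))
      ≤ 2 ^ n * Real.exp (r ^ 2 * ‖u‖ ^ 2 / 2) := by
  have h1 : ∀ ε : Fin n → Bool,
      RCLike.re (inner ℂ (∑ k, ((if ε k then r else -r : ℝ) : ℂ) • b k) u)
      = ∑ k, (if ε k then r * (inner ℂ (b k) u).re else -(r * (inner ℂ (b k) u).re)) := by
    intro ε
    rw [sum_inner, map_sum]
    refine Finset.sum_congr rfl fun k _ => ?_
    rw [inner_smul_left]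
    split_ifs <;> simp
  simp only [h1]
  rw [sum_prod_exp_sign]
  refine mul_le_mul_of_nonneg_left ?_ (by positivity)
  calc ∏ k, Real.cosh (r * (inner ℂ (b k) u).re)
      ≤ ∏ k, Real.exp ((r * (inner ℂ (b k) u).re) ^ 2 / 2) :=
        Finset.prod_le_prod (fun k _ => (Real.cosh_pos _).le)
          fun k _ => Real.cosh_le_exp_half_sq _
    _ = Real.exp (∑ k, (r * (inner ℂ (b k) u).re) ^ 2 / 2) := (Real.exp_sum _ _).symm
    _ ≤ _ := by
        rw [Real.exp_le_exp, ← b.sum_sq_norm_inner_right u, Finset.mul_sum, Finset.sum_div]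
        refine Finset.sum_le_sum fun k _ => ?_
        rw [mul_pow]
        have : (inner ℂ (b k) u).re ^ 2 ≤ ‖inner ℂ (b k) u‖ ^ 2 := by
          rw [← sq_abs]
          exact pow_le_pow_left₀ (abs_nonneg _) (Complex.abs_re_le_norm _) 2
        gcongr

theorem norm_flat {n : ℕ} (hn : n ≠ 0) (b : OrthonormalBasis (Fin n) ℂ E) (y : E)
    (ε : Fin n → Bool) :
    ‖∑ k, ((if ε k then ‖y‖ / √n else -(‖y‖ / √n) : ℝ) : ℂ) • b k‖ = ‖y‖ := by
  have h0 : (0 : ℝ) < n := by positivity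
  have h : ‖∑ k, ((if ε k then ‖y‖ / √n else -(‖y‖ / √n) : ℝ) : ℂ) • b k‖ ^ 2 = ‖y‖ ^ 2 := by
    rw [← b.sum_sq_norm_inner_right]
    have : ∀ k, ‖inner ℂ (b k)
        (∑ k, ((if ε k then ‖y‖ / √n else -(‖y‖ / √n) : ℝ) : ℂ) • b k)‖ ^ 2 = ‖y‖ ^ 2 / n := by
      intro k
      rw [b.orthonormal.inner_right_fintype, Complex.norm_real, Real.norm_eq_abs, sq_abs]
      split_ifs <;> simp [div_pow]
    rw [Finset.sum_congr rfl fun k _ => this k]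
    simp
    field_simp
  exact (pow_left_inj₀ (norm_nonneg _) (norm_nonneg _) two_ne_zero).1 h

theorem exists_unitary_sum_exp_le [FiniteDimensional ℂ E] [CompleteSpace E]
    {n : ℕ} (hn : n ≠ 0) (hE : Module.finrank ℂ E = n)
    {ι : Type*} (s : Finset ι) (x y : ι → E) (c : ι → ℝ) :
    ∃ U : unitary (E →L[ℂ] E),
      ∑ i ∈ s, Real.exp (c i + RCLike.re (inner ℂ (y i) ((U : E →L[ℂ] E) (x i))))
        ≤ ∑ i ∈ s, Real.exp (c i + ‖y i‖ ^ 2 * ‖x i‖ ^ 2 / (2 * n)) := by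
  have := compactSpace_unitary_clm (E := E)
  borelize ↥(unitary (E →L[ℂ] E))
  let μ : Measure (unitary (E →L[ℂ] E)) := Measure.haarMeasure ⊤
  have : IsProbabilityMeasure μ := ⟨Measure.haarMeasure_self⟩
  have hinteg : ∀ f : unitary (E →L[ℂ] E) → ℝ, Continuous f → Integrable f μ := fun f hf =>
    hf.integrable_of_hasCompactSupport (HasCompactSupport.of_compactSpace f)
  have hcont : ∀ x y : E, Continuous fun U : unitary (E →L[ℂ] E) =>
      Real.exp (RCLike.re (inner ℂ y ((U : E →L[ℂ] E) x))) := by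
    intro x y
    fun_prop
  have hinv : ∀ x y y' : E, ‖y‖ = ‖y'‖ →
      ∫ U, Real.exp (RCLike.re (inner ℂ y ((U : E →L[ℂ] E) x))) ∂μ
        = ∫ U, Real.exp (RCLike.re (inner ℂ y' ((U : E →L[ℂ] E) x))) ∂μ := by
    intro x y y' h
    obtain ⟨V, rfl⟩ := exists_unitary_clm_apply_eq h
    rw [← integral_mul_left_eq_self (μ := μ) (fun U : unitary (E →L[ℂ] E) =>
      Real.exp (RCLike.re (inner ℂ ((V : E →L[ℂ] E) y) ((U : E →L[ℂ] E) x)))) V]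
    refine integral_congr_ae (Filter.Eventually.of_forall fun U => ?_)
    have : inner ℂ ((V : E →L[ℂ] E) y) ((V : E →L[ℂ] E) ((U : E →L[ℂ] E) x))
        = inner ℂ y ((U : E →L[ℂ] E) x) :=
      (Unitary.linearIsometryEquiv (𝕜 := ℂ) (H := E) V).inner_map_map _ _
    simp [this]
  have hbd : ∀ x y : E, ∫ U, Real.exp (RCLike.re (inner ℂ y ((U : E →L[ℂ] E) x))) ∂μ
      ≤ Real.exp (‖y‖ ^ 2 * ‖x‖ ^ 2 / (2 * n)) := by
    intro x y
    let b : OrthonormalBasis (Fin n) ℂ E := (stdOrthonormalBasis ℂ E).reindex (finCongr hE)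
    let y' : (Fin n → Bool) → E := fun ε =>
      ∑ k, ((if ε k then ‖y‖ / √n else -(‖y‖ / √n) : ℝ) : ℂ) • b k
    have h1 : ∑ ε : Fin n → Bool,
        ∫ U, Real.exp (RCLike.re (inner ℂ (y' ε) ((U : E →L[ℂ] E) x))) ∂μ
        = 2 ^ n * ∫ U, Real.exp (RCLike.re (inner ℂ y ((U : E →L[ℂ] E) x))) ∂μ := by
      rw [Finset.sum_congr rfl fun ε _ => hinv x (y' ε) y (norm_flat hn b y ε)]
      simp
    rw [← integral_finsetSum _ fun ε _ => hinteg _ (hcont _ _)] at h1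
    have h2 : ∫ U, ∑ ε : Fin n → Bool,
        Real.exp (RCLike.re (inner ℂ (y' ε) ((U : E →L[ℂ] E) x))) ∂μ
        ≤ ∫ _U : unitary (E →L[ℂ] E), 2 ^ n * Real.exp (‖y‖ ^ 2 * ‖x‖ ^ 2 / (2 * n)) ∂μ := by
      refine integral_mono (hinteg _ (continuous_finsetSum _ fun ε _ => hcont _ _))
        (integrable_const _) fun U => ?_
      refine (sum_exp_re_inner_flat_le b (‖y‖ / √n) ((U : E →L[ℂ] E) x)).trans (le_of_eq ?_)
      rw [norm_unitary_clm_apply, div_pow, Real.sq_sqrt (Nat.cast_nonneg n)]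
      congr 2
      have : (n : ℝ) ≠ 0 := by exact_mod_cast hn
      field_simp
    rw [h1, integral_const] at h2
    simpa using h2
  have hterm : ∀ i, Continuous fun U : unitary (E →L[ℂ] E) =>
      Real.exp (c i + RCLike.re (inner ℂ (y i) ((U : E →L[ℂ] E) (x i)))) := by
    intro i
    fun_prop
  obtain ⟨U, hU⟩ := exists_le_integral (μ := μ)
    (hinteg _ (continuous_finsetSum s fun i _ => hterm i))
  refine ⟨U, hU.trans ?_⟩
  rw [integral_finsetSum _ fun i _ => hinteg _ (hterm i)]
  refine Finset.sum_le_sum fun i _ => ?_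
  simp only [Real.exp_add]
  rw [integral_const_mul]
  exact mul_le_mul_of_nonneg_left (hbd _ _) (Real.exp_pos _).le

end Haar

section Chaos

variable {E : Type*} [NormedAddCommGroup E] [InnerProductSpace ℂ E]

/-- The real part of `∑ p, ∑ q, B p q * ⟪u p, u q⟫`. -/
noncomputable def gramForm {ι : Type*} [Fintype ι] (B : Matrix ι ι ℂ) (u : ι → E) : ℝ :=
  (∑ p, ∑ q, B p q * inner ℂ (u p) (u q)).re

/-- The matrix left after eliminating the variable of index `0` from a quadratic form. -/
noncomputable def eliminate {k : ℕ} (B : Matrix (Fin (k + 1)) (Fin (k + 1)) ℂ) :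
    Matrix (Fin k) (Fin k) ℂ :=
  Matrix.of fun p q => B p.succ q.succ + 2 * (B p.succ 0 * star (B q.succ 0))

theorem eliminate_isHermitian {k : ℕ} {B : Matrix (Fin (k + 1)) (Fin (k + 1)) ℂ}
    (hB : B.IsHermitian) : (eliminate B).IsHermitian := by
  ext p q
  simp only [eliminate, Matrix.conjTranspose_apply, Matrix.of_apply, star_add, star_mul',
    hB.apply, star_ofNat]
  ring

theorem gramForm_succ {k : ℕ} {B : Matrix (Fin (k + 1)) (Fin (k + 1)) ℂ}
    (hB : B.IsHermitian) (u : Fin (k + 1) → E) :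
    gramForm B u = (B 0 0).re * ‖u 0‖ ^ 2
      + 2 * (inner ℂ (∑ p : Fin k, star (B p.succ 0) • u p.succ) (u 0)).re
      + gramForm (B.submatrix Fin.succ Fin.succ) (fun p => u p.succ) := by
  have h1 : (∑ q : Fin k, B 0 q.succ * inner ℂ (u 0) (u q.succ)).re
      = (inner ℂ (∑ p : Fin k, star (B p.succ 0) • u p.succ) (u 0)).re := by
    rw [sum_inner, Complex.re_sum, Complex.re_sum]
    refine Finset.sum_congr rfl fun q _ => ?_
    rw [inner_smul_left, ← hB.apply 0 q.succ, ← inner_conj_symm (u 0) (u q.succ)]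
    simp only [Complex.star_def, Complex.conj_conj, ← map_mul, Complex.conj_re]
  have h2 : (∑ p : Fin k, B p.succ 0 * inner ℂ (u p.succ) (u 0)).re
      = (inner ℂ (∑ p : Fin k, star (B p.succ 0) • u p.succ) (u 0)).re := by
    rw [sum_inner, Complex.re_sum, Complex.re_sum]
    refine Finset.sum_congr rfl fun q _ => ?_
    rw [inner_smul_left]
    simp
  have h3 : (B 0 0 * inner ℂ (u 0) (u 0)).re = (B 0 0).re * ‖u 0‖ ^ 2 := by
    rw [inner_self_eq_norm_sq_to_K]
    norm_cast
    simp [-Complex.ofReal_pow]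
  simp only [gramForm, Fin.sum_univ_succ, Finset.sum_add_distrib, Complex.add_re, h1, h2, h3,
    Matrix.submatrix_apply]
  ring

theorem gramForm_eliminate {k : ℕ} (B : Matrix (Fin (k + 1)) (Fin (k + 1)) ℂ) (u : Fin k → E) :
    gramForm (eliminate B) u = gramForm (B.submatrix Fin.succ Fin.succ) u
      + 2 * ‖∑ p : Fin k, star (B p.succ 0) • u p‖ ^ 2 := by
  have h : ((‖∑ p : Fin k, star (B p.succ 0) • u p‖ ^ 2 : ℝ) : ℂ)
      = ∑ p, ∑ q, B p.succ 0 * star (B q.succ 0) * inner ℂ (u p) (u q) := by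
    rw [Complex.ofReal_pow]
    refine (inner_self_eq_norm_sq_to_K (𝕜 := ℂ)
      (∑ p : Fin k, star (B p.succ 0) • u p)).symm.trans ?_
    rw [sum_inner]
    refine Finset.sum_congr rfl fun p _ => ?_
    rw [inner_sum]
    refine Finset.sum_congr rfl fun q _ => ?_
    rw [inner_smul_left, inner_smul_right]
    simp [mul_assoc]
  have h' := congrArg Complex.re h
  rw [Complex.ofReal_re] at h'
  rw [h']
  simp only [gramForm, eliminate, Matrix.of_apply, Matrix.submatrix_apply, add_mul,
    Finset.sum_add_distrib, Complex.add_re]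
  congr 1
  simp only [Complex.re_sum, Finset.mul_sum]
  refine Finset.sum_congr rfl fun p _ => Finset.sum_congr rfl fun q _ => ?_
  rw [mul_assoc]
  simp

theorem neg_quarter_le_re_diag {k : ℕ} {B : Matrix (Fin (k + 1)) (Fin (k + 1)) ℂ}
    (hB : B.IsHermitian)
    (hle : ∀ z : Fin (k + 1) → ℂ, |gramForm B z| ≤ (∑ p, ‖z p‖ ^ 2) / 4) :
    -(1 / 4) ≤ (B 0 0).re := by
  have h := (abs_le.1 (hle (Fin.cons 1 0))).1
  rw [gramForm_succ hB] at h
  simp [gramForm, Fin.sum_univ_succ] at h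
  linarith

theorem abs_gramForm_eliminate_le {k : ℕ} {B : Matrix (Fin (k + 1)) (Fin (k + 1)) ℂ}
    (hB : B.IsHermitian)
    (hle : ∀ z : Fin (k + 1) → ℂ, |gramForm B z| ≤ (∑ p, ‖z p‖ ^ 2) / 4) (z : Fin k → ℂ) :
    |gramForm (eliminate B) z| ≤ (∑ p, ‖z p‖ ^ 2) / 4 := by
  have h0 := neg_quarter_le_re_diag hB hle
  set w : ℂ := ∑ p : Fin k, star (B p.succ 0) • z p with hw
  have h1 := (abs_le.1 (hle (Fin.cons 0 z))).1
  have h2 := (abs_le.1 (hle (Fin.cons (2 * w) z))).2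
  rw [gramForm_succ hB] at h1 h2
  have h3 : (inner ℂ w (2 * w)).re = 2 * ‖w‖ ^ 2 := by
    rw [← smul_eq_mul, inner_smul_right, inner_self_eq_norm_sq_to_K]
    norm_cast
    simp [-Complex.ofReal_pow]
  simp only [Fin.cons_zero, Fin.cons_succ, Fin.sum_univ_succ, ← hw, h3, norm_zero, norm_mul,
    inner_zero_right, Complex.zero_re, Complex.norm_ofNat] at h1 h2
  rw [gramForm_eliminate, ← hw, abs_le]
  have h4 : 0 ≤ ‖w‖ ^ 2 := by positivity
  constructor
  · linarith
  · nlinarith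

theorem potential_eliminate_le {k : ℕ} {B : Matrix (Fin (k + 1)) (Fin (k + 1)) ℂ}
    (hB : B.IsHermitian)
    (hle : ∀ z : Fin (k + 1) → ℂ, |gramForm B z| ≤ (∑ p, ‖z p‖ ^ 2) / 4) :
    (B 0 0).re + (∑ p, (eliminate B p p).re + 2 * ∑ p, ∑ q, ‖eliminate B p q‖ ^ 2)
      ≤ ∑ p, (B p p).re + 2 * ∑ p, ∑ q, ‖B p q‖ ^ 2 := by
  set β : Fin k → ℂ := fun p => B p.succ 0 with hβ
  set S : ℝ := ∑ p, ‖β p‖ ^ 2 with hS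
  have hstar : ∀ z : ℂ, star z * z = ((‖z‖ ^ 2 : ℝ) : ℂ) := by
    intro z
    rw [Complex.star_def, mul_comm, Complex.mul_conj, Complex.normSq_eq_norm_sq]
  have hw : ∑ p : Fin k, star (B p.succ 0) • β p = ((S : ℝ) : ℂ) := by
    rw [hS, Complex.ofReal_sum]
    exact Finset.sum_congr rfl fun p _ => hstar _
  have hS0 : 0 ≤ S := Finset.sum_nonneg fun p _ => by positivity
  have h1 := (abs_le.1 (abs_gramForm_eliminate_le hB hle β)).2
  rw [gramForm_eliminate, hw, Complex.norm_real, Real.norm_eq_abs, sq_abs] at h1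
  have htr : ∑ p, (eliminate B p p).re = ∑ p : Fin k, (B p.succ p.succ).re + 2 * S := by
    rw [hS, Finset.mul_sum, ← Finset.sum_add_distrib]
    refine Finset.sum_congr rfl fun p _ => ?_
    have := hstar (B p.succ 0)
    rw [mul_comm] at this
    simp only [eliminate, Matrix.of_apply, this, hβ, Complex.add_re]
    norm_cast
  have hsq : ∑ p, ∑ q, ‖eliminate B p q‖ ^ 2 = ∑ p : Fin k, ∑ q : Fin k, ‖B p.succ q.succ‖ ^ 2
      + 4 * gramForm (B.submatrix Fin.succ Fin.succ) β + 4 * S ^ 2 := by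
    have hS2 : S ^ 2 = ∑ p, ∑ q, ‖β p‖ ^ 2 * ‖β q‖ ^ 2 := by
      rw [sq, hS, Finset.sum_mul_sum]
    rw [hS2]
    simp only [gramForm, Complex.re_sum, Finset.mul_sum, ← Finset.sum_add_distrib]
    refine Finset.sum_congr rfl fun p _ => Finset.sum_congr rfl fun q _ => ?_
    simp only [eliminate, Matrix.of_apply, Matrix.submatrix_apply, hβ, ← Complex.normSq_eq_norm_sq,
      Complex.normSq_apply, RCLike.inner_apply, Complex.star_def]
    simp
    ring
  have htot : ∑ p, ∑ q, ‖B p q‖ ^ 2 = ‖B 0 0‖ ^ 2 + 2 * S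
      + ∑ p : Fin k, ∑ q : Fin k, ‖B p.succ q.succ‖ ^ 2 := by
    have : ∀ q : Fin k, ‖B 0 q.succ‖ = ‖B q.succ 0‖ := by
      intro q
      rw [← hB.apply 0 q.succ, norm_star]
    simp only [Fin.sum_univ_succ, Finset.sum_add_distrib, this, hS, hβ]
    ring
  rw [htr, hsq, htot, Fin.sum_univ_succ]
  nlinarith [sq_nonneg ‖B 0 0‖, sq_nonneg S]

theorem exists_unitaries_sum_exp_gramForm_le [FiniteDimensional ℂ E] [CompleteSpace E]
    {n : ℕ} (hn : n ≠ 0) (hE : Module.finrank ℂ E = n) {ι : Type*} (s : Finset ι) (x : ι → E)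
    (hx : ∀ i, ‖x i‖ = 1) (k : ℕ) (B : ι → Matrix (Fin k) (Fin k) ℂ) (c : ι → ℝ)
    (hB : ∀ i, (B i).IsHermitian)
    (hle : ∀ i (z : Fin k → ℂ), |gramForm (B i) z| ≤ (∑ p, ‖z p‖ ^ 2) / 4) :
    ∃ U : Fin k → unitary (E →L[ℂ] E),
      ∑ i ∈ s, Real.exp (c i + n * gramForm (B i) fun p => (U p : E →L[ℂ] E) (x i))
        ≤ ∑ i ∈ s, Real.exp
          (c i + n * (∑ p, (B i p p).re + 2 * ∑ p, ∑ q, ‖B i p q‖ ^ 2)) := by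
  induction k generalizing c with
  | zero => exact ⟨Fin.elim0, by simp [gramForm]⟩
  | succ k ih =>
    obtain ⟨U, hU⟩ := ih (fun i => eliminate (B i)) (fun i => c i + n * (B i 0 0).re)
      (fun i => eliminate_isHermitian (hB i)) (fun i => abs_gramForm_eliminate_le (hB i) (hle i))
    let v : ι → E := fun i => ∑ p : Fin k, star (B i p.succ 0) • (U p : E →L[ℂ] E) (x i)
    obtain ⟨U₀, hU₀⟩ := exists_unitary_sum_exp_le hn hE s x (fun i => ((2 * n : ℝ) : ℂ) • v i)
      (fun i => c i + n * (B i 0 0).re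
        + n * gramForm ((B i).submatrix Fin.succ Fin.succ) fun p => (U p : E →L[ℂ] E) (x i))
    have hn' : (n : ℝ) ≠ 0 := by exact_mod_cast hn
    refine ⟨Fin.cons U₀ U, ?_⟩
    calc _ = _ := Finset.sum_congr rfl fun i _ => ?_
      _ ≤ _ := hU₀
      _ = _ := Finset.sum_congr rfl fun i _ => ?_
      _ ≤ _ := hU
      _ ≤ _ := Finset.sum_le_sum fun i _ => ?_
    · rw [gramForm_succ (hB i)]
      simp only [Fin.cons_zero, Fin.cons_succ, norm_unitary_clm_apply, hx]
      rw [inner_smul_left, Complex.conj_ofReal]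
      congr 1
      simp only [RCLike.re_to_complex, Complex.re_ofReal_mul, v]
      ring
    · rw [gramForm_eliminate]
      congr 1
      rw [norm_smul, hx, Complex.norm_real, Real.norm_eq_abs, mul_pow, sq_abs]
      simp only [v]
      field_simp
      ring
    · rw [Real.exp_le_exp, add_assoc, ← mul_add]
      have := potential_eliminate_le (hB i) (hle i)
      gcongr

end Chaos

section Net

open MeasureTheory

/-- A `1/4`-separated subset of the unit sphere has at most `9 ^ dim` points. -/
theorem card_le_of_quarter_separated {E : Type*} [NormedAddCommGroup E] [NormedSpace ℝ E]
    [FiniteDimensional ℝ E] (s : Finset E) (hs : ∀ c ∈ s, ‖c‖ = 1)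
    (h : ∀ c ∈ s, ∀ d ∈ s, c ≠ d → 1 / 4 ≤ ‖c - d‖) : s.card ≤ 9 ^ Module.finrank ℝ E := by
  borelize E
  let μ : Measure E := Measure.addHaar
  have hδ : (0 : ℝ) < 1 / 8 := by norm_num
  have hρ : (0 : ℝ) < 9 / 8 := by norm_num
  have hdisj : Set.PairwiseDisjoint (s : Set E) fun c => Metric.ball (c : E) (1 / 8) := by
    intro c hc d hd hcd
    apply Metric.ball_disjoint_ball
    rw [dist_eq_norm]
    linarith [h c hc d hd hcd]
  have hsub : (⋃ c ∈ s, Metric.ball (c : E) (1 / 8)) ⊆ Metric.ball (0 : E) (9 / 8) := by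
    refine Set.iUnion₂_subset fun x hx => Metric.ball_subset_ball' ?_
    rw [dist_zero_right, hs x hx]
    norm_num
  have hvol : (s.card : ENNReal) * ENNReal.ofReal ((1 / 8) ^ Module.finrank ℝ E)
      * μ (Metric.ball 0 1)
      ≤ ENNReal.ofReal ((9 / 8) ^ Module.finrank ℝ E) * μ (Metric.ball 0 1) := by
    calc _ = μ (⋃ c ∈ s, Metric.ball (c : E) (1 / 8)) := by
          rw [measure_biUnion_finset hdisj fun c _ => measurableSet_ball]
          simp only [μ.addHaar_ball_of_pos _ hδ, Finset.sum_const, nsmul_eq_mul, mul_assoc]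
      _ ≤ μ (Metric.ball (0 : E) (9 / 8)) := measure_mono hsub
      _ = _ := by simp only [μ.addHaar_ball_of_pos _ hρ]
  have hvol' := (ENNReal.mul_le_mul_iff_left
    (Metric.measure_ball_pos μ _ zero_lt_one).ne' measure_ball_lt_top.ne).1 hvol
  have hle := ENNReal.toReal_le_of_le_ofReal (pow_nonneg hρ.le _) hvol'
  rw [ENNReal.toReal_mul, ENNReal.toReal_natCast, ENNReal.toReal_ofReal (by positivity),
    div_pow, div_pow, one_pow, mul_one_div] at hle
  have := (div_le_div_iff_of_pos_right (by positivity)).1 hle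
  exact_mod_cast this

/-- The unit sphere has a `1/4`-net with at most `9 ^ dim` points. -/
theorem exists_quarter_net_sphere (E : Type*) [NormedAddCommGroup E] [NormedSpace ℝ E]
    [FiniteDimensional ℝ E] :
    ∃ T : Finset E, (∀ y ∈ T, ‖y‖ = 1) ∧ T.card ≤ 9 ^ Module.finrank ℝ E ∧
      ∀ x : E, ‖x‖ = 1 → ∃ y ∈ T, ‖x - y‖ ≤ 1 / 4 := by
  classical
  let P : Finset E → Prop := fun s => (∀ c ∈ s, ‖c‖ = 1) ∧
    ∀ c ∈ s, ∀ d ∈ s, c ≠ d → 1 / 4 ≤ ‖c - d‖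
  have hne : {m | ∃ s, P s ∧ s.card = m}.Nonempty := ⟨0, ∅, by simp [P]⟩
  have hbdd : BddAbove {m | ∃ s, P s ∧ s.card = m} := by
    refine ⟨9 ^ Module.finrank ℝ E, ?_⟩
    rintro _ ⟨s, hs, rfl⟩
    exact card_le_of_quarter_separated s hs.1 hs.2
  obtain ⟨T, hT, hcard⟩ := Nat.sSup_mem hne hbdd
  refine ⟨T, hT.1, card_le_of_quarter_separated T hT.1 hT.2, fun x hx => ?_⟩
  by_contra! hfar
  have hxT : x ∉ T := fun hxT => by
    have := hfar x hxT
    norm_num at this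
  have hins : P (insert x T) := by
    refine ⟨?_, ?_⟩
    · intro c hc
      rcases Finset.mem_insert.1 hc with rfl | hc
      exacts [hx, hT.1 c hc]
    · intro c hc d hd hcd
      rcases Finset.mem_insert.1 hc with rfl | hc' <;>
        rcases Finset.mem_insert.1 hd with rfl | hd'
      · exact absurd rfl hcd
      · exact (hfar d hd').le
      · rw [norm_sub_rev]
        exact (hfar c hc').le
      · exact hT.2 c hc' d hd' hcd
  have := le_csSup hbdd ⟨_, hins, rfl⟩
  rw [← hcard, Finset.card_insert_of_notMem hxT] at this
  omega

end Net

section Gram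

variable {E : Type*} [NormedAddCommGroup E] [InnerProductSpace ℂ E]

/-- The conjugate Gram matrix of a family, as a vector in a Euclidean space. -/
noncomputable def gramVec {d : ℕ} (u : Fin d → E) : EuclideanSpace ℂ (Fin d × Fin d) :=
  WithLp.toLp 2 fun pq => inner ℂ (u pq.2) (u pq.1)

/-- The conjugate Gram matrix of a family with the diagonal replaced by `0`. -/
noncomputable def offGramVec {d : ℕ} (u : Fin d → E) : EuclideanSpace ℂ (Fin d × Fin d) :=
  WithLp.toLp 2 fun pq => if pq.1 = pq.2 then 0 else inner ℂ (u pq.2) (u pq.1)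

/-- Hermitian matrices with zero diagonal in the unit ball of the Frobenius norm. -/
def hollowHermitianBall (d : ℕ) : Set (EuclideanSpace ℂ (Fin d × Fin d)) :=
  {a | (∀ p q, a (p, q) = star (a (q, p))) ∧ (∀ p, a (p, p) = 0) ∧ ‖a‖ ≤ 1}

theorem gramForm_of {d : ℕ} (a : EuclideanSpace ℂ (Fin d × Fin d)) (u : Fin d → E) :
    gramForm (Matrix.of fun p q => a (p, q)) u = (inner ℂ (gramVec u) a).re := by
  rw [PiLp.inner_apply, Fintype.sum_prod_type]
  simp [gramForm, gramVec]

theorem gramForm_of_hollow {d : ℕ} {a : EuclideanSpace ℂ (Fin d × Fin d)}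
    (ha : ∀ p, a (p, p) = 0) (u : Fin d → E) :
    gramForm (Matrix.of fun p q => a (p, q)) u = (inner ℂ (offGramVec u) a).re := by
  rw [gramForm_of, PiLp.inner_apply, PiLp.inner_apply]
  congr 1
  refine Finset.sum_congr rfl fun pq _ => ?_
  obtain ⟨p, q⟩ := pq
  by_cases h : p = q
  · subst h
    simp [ha]
  · simp [gramVec, offGramVec, h]

theorem norm_gramVec_complex {d : ℕ} (z : Fin d → ℂ) : ‖gramVec z‖ = ∑ p, ‖z p‖ ^ 2 := by
  have h : ‖gramVec z‖ ^ 2 = (∑ p, ‖z p‖ ^ 2) ^ 2 := by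
    rw [EuclideanSpace.norm_sq_eq, Fintype.sum_prod_type, sq (∑ p, ‖z p‖ ^ 2), Finset.sum_mul_sum]
    refine Finset.sum_congr rfl fun p _ => Finset.sum_congr rfl fun q _ => ?_
    simp [gramVec, mul_pow]
  exact (pow_left_inj₀ (norm_nonneg _) (by positivity) two_ne_zero).1 h

theorem abs_gramForm_of_le {d : ℕ} {a : EuclideanSpace ℂ (Fin d × Fin d)} (ha : ‖a‖ ≤ 1)
    (z : Fin d → ℂ) :
    |gramForm (Matrix.of fun p q => a (p, q)) z| ≤ ∑ p, ‖z p‖ ^ 2 := by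
  rw [gramForm_of, ← norm_gramVec_complex]
  calc _ ≤ ‖inner ℂ (gramVec z) a‖ := Complex.abs_re_le_norm _
    _ ≤ ‖gramVec z‖ * ‖a‖ := norm_inner_le_norm _ _
    _ ≤ ‖gramVec z‖ * 1 := by gcongr
    _ = _ := mul_one _

theorem exists_half_net_hollowHermitianBall (d : ℕ) :
    ∃ A : Finset (EuclideanSpace ℂ (Fin d × Fin d)), (∀ a ∈ A, a ∈ hollowHermitianBall d) ∧
      ∀ e ∈ hollowHermitianBall d, ∃ a ∈ A, ‖a - e‖ ≤ 1 / 2 := by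
  have htb : TotallyBounded (hollowHermitianBall d) :=
    (isCompact_closedBall (0 : EuclideanSpace ℂ (Fin d × Fin d)) 1).totallyBounded.subset
      fun a ha => mem_closedBall_zero_iff.2 ha.2.2
  obtain ⟨t, hts, htf, hcov⟩ := Metric.finite_approx_of_totallyBounded htb (1 / 2) (by norm_num)
  refine ⟨htf.toFinset, fun a ha => hts (htf.mem_toFinset.1 ha), fun e he => ?_⟩
  obtain ⟨a, ha, hea⟩ := Set.mem_iUnion₂.1 (hcov he)
  refine ⟨a, htf.mem_toFinset.2 ha, ?_⟩
  rw [← dist_eq_norm, dist_comm]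
  exact (Metric.mem_ball.1 hea).le

/-- The norm of the off-diagonal Gram matrix is controlled by its pairing with a net. -/
theorem norm_offGramVec_le {d : ℕ} {A : Finset (EuclideanSpace ℂ (Fin d × Fin d))}
    (hA : ∀ e ∈ hollowHermitianBall d, ∃ a ∈ A, ‖a - e‖ ≤ 1 / 2) (u : Fin d → E) {K : ℝ}
    (hK : ∀ a ∈ A, (inner ℂ (offGramVec u) a).re ≤ K) : ‖offGramVec u‖ ≤ 2 * max K 0 := by
  set e := offGramVec u with he
  rcases eq_or_ne e 0 with h0 | h0
  · rw [h0, norm_zero]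
    positivity
  have hpos : 0 < ‖e‖ := norm_pos_iff.2 h0
  set f : EuclideanSpace ℂ (Fin d × Fin d) := ((‖e‖⁻¹ : ℝ) : ℂ) • e with hf
  have hfmem : f ∈ hollowHermitianBall d := by
    refine ⟨fun p q => ?_, fun p => ?_, ?_⟩
    · by_cases h : p = q
      · simp [hf, he, offGramVec, h]
      · simp [hf, he, offGramVec, h, Ne.symm h]
    · simp [hf, he, offGramVec]
    · rw [hf, norm_smul, Complex.norm_real, norm_inv, norm_norm, inv_mul_cancel₀ hpos.ne']
  obtain ⟨a, ha, hae⟩ := hA f hfmem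
  have h1 : (inner ℂ e f).re = ‖e‖ := by
    rw [hf, inner_smul_right, Complex.re_ofReal_mul]
    have : (inner ℂ e e).re = ‖e‖ ^ 2 := inner_self_eq_norm_sq (𝕜 := ℂ) e
    rw [this]
    field_simp
  have h2 : |(inner ℂ e (a - f)).re| ≤ ‖e‖ * (1 / 2) :=
    (Complex.abs_re_le_norm _).trans ((norm_inner_le_norm _ _).trans (by gcongr))
  rw [inner_sub_right, Complex.sub_re, h1] at h2
  have h3 := (abs_le.1 h2).1
  have h4 := hK a ha
  have h5 := le_max_left K 0
  linarith

theorem offGramVec_clm_smul {d : ℕ} (U : Fin d → E →L[ℂ] E) (r : ℝ) (x : E) :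
    offGramVec (fun p => U p ((r : ℂ) • x))
      = ((r ^ 2 : ℝ) : ℂ) • offGramVec fun p => U p x := by
  ext ⟨p, q⟩
  by_cases h : p = q
  · simp [offGramVec, h]
  · simp only [offGramVec, h, map_smul, if_false, PiLp.smul_apply, smul_eq_mul, inner_smul_left,
      inner_smul_right, Complex.conj_ofReal]
    push_cast
    ring

theorem offGramVec_clm_polarization {d : ℕ} (U : Fin d → E →L[ℂ] E) (x y : E) :
    offGramVec (fun p => U p x) - offGramVec (fun p => U p y)
      = (1 / 36 : ℂ) • (offGramVec (fun p => U p ((10 : ℂ) • x - (8 : ℂ) • y))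
          - offGramVec fun p => U p ((8 : ℂ) • x - (10 : ℂ) • y)) := by
  ext ⟨p, q⟩
  by_cases h : p = q
  · simp [offGramVec, h]
  · simp only [offGramVec, h, map_smul, map_sub, if_false, PiLp.smul_apply, PiLp.sub_apply,
      smul_eq_mul, inner_smul_left, inner_smul_right, inner_sub_left, inner_sub_right, map_ofNat]
    ring

theorem continuous_offGramVec_clm {d : ℕ} (U : Fin d → E →L[ℂ] E) :
    Continuous fun x => offGramVec fun p => U p x := by
  refine (PiLp.continuous_toLp 2 _).comp (continuous_pi fun pq => ?_)
  by_cases h : pq.1 = pq.2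
  · simpa [h] using continuous_const
  · simp only [h, if_false]
    fun_prop

/-- A bound for the off-diagonal Gram matrix on a `1/4`-net of the sphere extends to the whole
sphere at the cost of a factor `2`. -/
theorem norm_offGramVec_clm_le_of_net [FiniteDimensional ℂ E] {d : ℕ} (U : Fin d → E →L[ℂ] E)
    {T : Finset E} (hT1 : ∀ y ∈ T, ‖y‖ = 1)
    (hT : ∀ x : E, ‖x‖ = 1 → ∃ y ∈ T, ‖x - y‖ ≤ 1 / 4) {K : ℝ}
    (hK : ∀ y ∈ T, ‖offGramVec fun p => U p y‖ ≤ K) {x : E} (hx : ‖x‖ = 1) :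
    ‖offGramVec fun p => U p x‖ ≤ 2 * K := by
  have : ProperSpace E := FiniteDimensional.proper ℂ E
  set e : E → EuclideanSpace ℂ (Fin d × Fin d) := fun x => offGramVec fun p => U p x with he
  obtain ⟨x₀, hx₀, hmax⟩ := (isCompact_sphere (0 : E) 1).exists_isMaxOn
    ⟨x, by simpa using hx⟩ (continuous_offGramVec_clm U).norm.continuousOn
  set M := ‖e x₀‖ with hM
  have hM0 : 0 ≤ M := norm_nonneg _
  have hle : ∀ z, ‖z‖ = 1 → ‖e z‖ ≤ M := fun z hz => hmax (by simpa using hz)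
  have hhom : ∀ z, ‖e z‖ ≤ M * ‖z‖ ^ 2 := by
    intro z
    rcases eq_or_ne z 0 with rfl | hz
    · have : e 0 = 0 := by
        ext ⟨p, q⟩
        simp [he, offGramVec]
      simp [this]
    · have hz' : ‖z‖ ≠ 0 := norm_ne_zero_iff.2 hz
      have h1 : z = ((‖z‖ : ℝ) : ℂ) • (((‖z‖⁻¹ : ℝ) : ℂ) • z) := by
        rw [smul_smul, ← Complex.ofReal_mul, mul_inv_cancel₀ hz', Complex.ofReal_one, one_smul]
      have h2 : ‖((‖z‖⁻¹ : ℝ) : ℂ) • z‖ = 1 := by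
        rw [norm_smul, Complex.norm_real, norm_inv, norm_norm, inv_mul_cancel₀ hz']
      have h3 : e z = ((‖z‖ ^ 2 : ℝ) : ℂ) • e (((‖z‖⁻¹ : ℝ) : ℂ) • z) := by
        conv_lhs => rw [h1]
        exact offGramVec_clm_smul U _ _
      rw [h3, norm_smul, Complex.norm_real, Real.norm_of_nonneg (by positivity), mul_comm]
      have := hle _ h2
      gcongr
  have hx₀1 : ‖x₀‖ = 1 := by simpa using hx₀
  obtain ⟨y, hy, hxy⟩ := hT x₀ hx₀1
  have hy1 := hT1 y hy
  have hnorm : ‖(10 : ℂ) • x₀ - (8 : ℂ) • y‖ ^ 2 + ‖(8 : ℂ) • x₀ - (10 : ℂ) • y‖ ^ 2 ≤ 18 := by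
    have h1 : ‖x₀ - y‖ ^ 2 ≤ 1 / 16 := by
      have := pow_le_pow_left₀ (norm_nonneg _) hxy 2
      linarith
    rw [norm_sub_sq (𝕜 := ℂ), hx₀1, hy1] at h1
    rw [norm_sub_sq (𝕜 := ℂ), norm_sub_sq (𝕜 := ℂ)]
    simp only [norm_smul, inner_smul_left, inner_smul_right, hx₀1, hy1, Complex.norm_ofNat,
      RCLike.re_to_complex] at h1 ⊢
    simp
    linarith
  have hdiff : ‖e x₀ - e y‖ ≤ M / 2 := by
    rw [he]
    simp only
    rw [offGramVec_clm_polarization U x₀ y, norm_smul]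
    have h1 := hhom ((10 : ℂ) • x₀ - (8 : ℂ) • y)
    have h2 := hhom ((8 : ℂ) • x₀ - (10 : ℂ) • y)
    have h3 := norm_sub_le (e ((10 : ℂ) • x₀ - (8 : ℂ) • y)) (e ((8 : ℂ) • x₀ - (10 : ℂ) • y))
    have h4 : ‖(1 / 36 : ℂ)‖ = 1 / 36 := by simp
    rw [h4]
    simp only [he] at h1 h2 h3
    nlinarith
  have h1 : M ≤ ‖e y‖ + ‖e x₀ - e y‖ := by
    rw [hM]
    have := norm_add_le (e y) (e x₀ - e y)
    rwa [add_sub_cancel] at this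
  have h2 := hK y hy
  have h3 := hle x hx
  linarith

/-- For large `n` there are `d` unitaries of size `n` such that the orbits of all unit vectors are
almost orthogonal: their off-diagonal Gram matrices are bounded independently of `d`. -/
theorem exists_unitaries_norm_offGramVec_le (d : ℕ) :
    ∃ N : ℕ, 1 ≤ N ∧ ∀ n : ℕ, N ≤ n →
      ∃ U : Fin d → unitary (EuclideanSpace ℂ (Fin n) →L[ℂ] EuclideanSpace ℂ (Fin n)),
        ∀ x : EuclideanSpace ℂ (Fin n), ‖x‖ = 1 →
          ‖offGramVec fun p =>
            (U p : EuclideanSpace ℂ (Fin n) →L[ℂ] EuclideanSpace ℂ (Fin n)) x‖ ≤ 112 := by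
  obtain ⟨A, hAmem, hA⟩ := exists_half_net_hollowHermitianBall d
  refine ⟨max 1 A.card, le_max_left _ _, fun n hn => ?_⟩
  have hn1 : n ≠ 0 := by
    have := (le_max_left 1 A.card).trans hn
    omega
  have hAn : A.card ≤ n := (le_max_right 1 A.card).trans hn
  obtain ⟨T, hT1, hTcard, hT⟩ := exists_quarter_net_sphere (EuclideanSpace ℂ (Fin n))
  have hfr : Module.finrank ℂ (EuclideanSpace ℂ (Fin n)) = n := by simp
  rw [finrank_real_of_complex, hfr] at hTcard
  obtain ⟨U, hU⟩ := exists_unitaries_sum_exp_gramForm_le hn1 hfr (T ×ˢ A).attach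
    (fun i => i.1.1) (fun i => hT1 _ (Finset.mem_product.1 i.2).1) d
    (fun i => Matrix.of fun p q => ((1 / 4 : ℂ) • i.1.2) (p, q)) (fun _ => 0)
    (fun i => by
      ext p q
      have := (hAmem _ (Finset.mem_product.1 i.2).2).1 p q
      simp [this])
    (fun i z => by
      have h1 := abs_gramForm_of_le (hAmem _ (Finset.mem_product.1 i.2).2).2.2 z
      rw [gramForm_of] at h1 ⊢
      have h4 : (1 / 4 : ℂ) = ((1 / 4 : ℝ) : ℂ) := by norm_num
      rw [inner_smul_right, h4, Complex.re_ofReal_mul, abs_mul, abs_of_pos (by norm_num)]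
      linarith)
  have hRHS : ∀ i ∈ (T ×ˢ A).attach,
      Real.exp (0 + n * (∑ p : Fin d, (((1 / 4 : ℂ) • i.1.2) (p, p)).re
        + 2 * ∑ p : Fin d, ∑ q : Fin d, ‖((1 / 4 : ℂ) • i.1.2) (p, q)‖ ^ 2))
      ≤ Real.exp n := by
    intro i _
    have hi := hAmem _ (Finset.mem_product.1 i.2).2
    have h1 : ∑ p : Fin d, ∑ q : Fin d, ‖((1 / 4 : ℂ) • i.1.2) (p, q)‖ ^ 2 = ‖i.1.2‖ ^ 2 / 16 := by
      rw [← Fintype.sum_prod_type (f := fun pq : Fin d × Fin d =>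
        ‖((1 / 4 : ℂ) • i.1.2) pq‖ ^ 2), ← EuclideanSpace.norm_sq_eq, norm_smul]
      simp
      ring
    have h2 : ‖i.1.2‖ ^ 2 ≤ 1 := pow_le_one₀ (norm_nonneg _) hi.2.2
    rw [Real.exp_le_exp, h1]
    simp only [PiLp.smul_apply, hi.2.1, smul_zero, Complex.zero_re, Finset.sum_const_zero, zero_add]
    have : (0 : ℝ) ≤ n := by positivity
    nlinarith
  have hsum := hU.trans (Finset.sum_le_sum hRHS)
  rw [Finset.sum_const, nsmul_eq_mul, Finset.card_attach, Finset.card_product] at hsum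
  have hbound : (((T.card * A.card : ℕ) : ℝ)) * Real.exp n ≤ Real.exp (7 * n) := by
    have h81 : (81 : ℝ) ≤ Real.exp 5 := by
      have h1 : (2.7 : ℝ) ^ 5 ≤ Real.exp 1 ^ 5 := by
        gcongr
        linarith [Real.exp_one_gt_d9]
      rw [← Real.exp_nat_mul] at h1
      norm_num at h1 ⊢
      linarith
    have hTc : (T.card : ℝ) ≤ Real.exp (5 * n) := by
      calc (T.card : ℝ) ≤ ((9 ^ (2 * n) : ℕ) : ℝ) := by exact_mod_cast hTcard
        _ = 81 ^ n := by
          rw [pow_mul]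
          norm_num
        _ ≤ Real.exp 5 ^ n := by gcongr
        _ = _ := by rw [← Real.exp_nat_mul, mul_comm]
    have hAc : (A.card : ℝ) ≤ Real.exp n := by
      have h1 : (A.card : ℝ) ≤ n := by exact_mod_cast hAn
      linarith [Real.add_one_le_exp (n : ℝ)]
    calc (((T.card * A.card : ℕ) : ℝ)) * Real.exp n
        ≤ (Real.exp (5 * n) * Real.exp n) * Real.exp n := by
          push_cast
          gcongr
      _ = _ := by
          rw [← Real.exp_add, ← Real.exp_add]
          ring_nf
  refine ⟨U, fun x hx => ?_⟩
  have hnet : ∀ y ∈ T, ∀ a ∈ A,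
      (inner ℂ (offGramVec fun p =>
        (U p : EuclideanSpace ℂ (Fin n) →L[ℂ] EuclideanSpace ℂ (Fin n)) y) a).re ≤ 28 := by
    intro y hy a ha
    have h1 := (Finset.single_le_sum (fun i _ => (Real.exp_pos _).le)
      (Finset.mem_attach (T ×ˢ A) ⟨(y, a), Finset.mk_mem_product hy ha⟩)).trans
        (hsum.trans hbound)
    rw [Real.exp_le_exp] at h1
    simp only at h1
    rw [gramForm_of_hollow (fun p => by simp [(hAmem a ha).2.1])] at h1
    have h4 : (1 / 4 : ℂ) = ((1 / 4 : ℝ) : ℂ) := by norm_num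
    rw [inner_smul_right, h4, Complex.re_ofReal_mul] at h1
    have hnpos : (0 : ℝ) < n := by positivity
    nlinarith
  have := norm_offGramVec_clm_le_of_net
    (fun p => (U p : EuclideanSpace ℂ (Fin n) →L[ℂ] EuclideanSpace ℂ (Fin n)))
    hT1 hT (fun y hy => norm_offGramVec_le hA _ (hnet y hy)) hx
  norm_num at this
  exact this

end Gram

section Entropy

open scoped Matrix.Norms.Frobenius

theorem frobenius_norm_sq {m : Type*} [Fintype m] (A : Matrix m m ℂ) :
    ‖A‖ ^ 2 = (Aᴴ * A).trace.re := by
  rw [Matrix.frobenius_norm_def, ← Real.sqrt_eq_rpow, Real.sq_sqrt (by positivity),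
    Matrix.trace, Complex.re_sum, Finset.sum_comm]
  refine Finset.sum_congr rfl fun j _ => ?_
  rw [Matrix.diag_apply, Matrix.mul_apply, Complex.re_sum]
  refine Finset.sum_congr rfl fun i _ => ?_
  rw [Matrix.conjTranspose_apply, Complex.star_def, mul_comm, Complex.mul_conj,
    Complex.normSq_eq_norm_sq, Complex.ofReal_re, Real.rpow_ofNat]

theorem sum_eigenvalues_eq_one {m : Type*} [Fintype m] [DecidableEq m] {A : Matrix m m ℂ}
    (hA : A.IsHermitian) (htr : A.trace = 1) : ∑ i, hA.eigenvalues i = 1 := by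
  have h := congrArg Complex.re hA.trace_eq_sum_eigenvalues
  rw [htr, Complex.re_sum] at h
  exact h.symm

theorem sum_eigenvalues_sq {m : Type*} [Fintype m] [DecidableEq m] {A : Matrix m m ℂ}
    (hA : A.IsHermitian) : ∑ i, hA.eigenvalues i ^ 2 = ‖A‖ ^ 2 := by
  rw [frobenius_norm_sq, hA.eq]
  have h : A * A = Unitary.conjStarAlgAut ℂ _ hA.eigenvectorUnitary
      (diagonal (RCLike.ofReal ∘ hA.eigenvalues) * diagonal (RCLike.ofReal ∘ hA.eigenvalues)) := by
    rw [map_mul, ← hA.spectral_theorem]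
  rw [h, Unitary.conjStarAlgAut_apply, Matrix.trace_mul_cycle, Unitary.coe_star_mul_self,
    one_mul, diagonal_mul_diagonal, trace_diagonal, Complex.re_sum]
  refine Finset.sum_congr rfl fun i _ => ?_
  simp [sq]

theorem eq_sum_eigenvalues_smul_vecMulVec {m : Type*} [Fintype m] [DecidableEq m]
    {A : Matrix m m ℂ} (hA : A.IsHermitian) :
    A = ∑ k, (hA.eigenvalues k : ℂ) •
      vecMulVec (hA.eigenvectorBasis k).ofLp (star (hA.eigenvectorBasis k).ofLp) := by
  conv_lhs => rw [hA.spectral_theorem, Unitary.conjStarAlgAut_apply]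
  ext a b
  rw [Matrix.mul_apply, Matrix.sum_apply]
  refine Finset.sum_congr rfl fun k _ => ?_
  simp only [Matrix.mul_diagonal, Matrix.IsHermitian.eigenvectorUnitary_apply, Matrix.smul_apply,
    vecMulVec_apply, Matrix.star_apply, Function.comp_apply, smul_eq_mul, Pi.star_apply]
  simp
  ring

/-- The von Neumann entropy of a state is at least its collision entropy. -/
theorem neg_log_le_vnEntropy {m : Type*} [Fintype m] [DecidableEq m] {A : Matrix m m ℂ}
    (hA : A.PosSemidef) (htr : A.trace = 1) {M : ℝ} (hM0 : 0 < M) (hM : ‖A‖ ^ 2 ≤ M) :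
    -Real.log M ≤ vnEntropy A := by
  rw [vnEntropy, dif_pos hA.isHermitian, neg_le_neg_iff]
  have hsum : ∑ i, hA.isHermitian.eigenvalues i = 1 :=
    sum_eigenvalues_eq_one hA.isHermitian htr
  rw [← sum_eigenvalues_sq hA.isHermitian] at hM
  calc _ ≤ ∑ i, (hA.isHermitian.eigenvalues i ^ 2 / M - hA.isHermitian.eigenvalues i
        + hA.isHermitian.eigenvalues i * Real.log M) := by
        refine Finset.sum_le_sum fun i _ => ?_
        rcases (hA.eigenvalues_nonneg i).eq_or_lt with h | h
        · simp [← h]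
        · have h1 := Real.log_le_sub_one_of_pos (div_pos h hM0)
          rw [Real.log_div h.ne' hM0.ne'] at h1
          have h2 := mul_le_mul_of_nonneg_left h1 h.le
          have h3 : hA.isHermitian.eigenvalues i * (hA.isHermitian.eigenvalues i / M - 1)
            = hA.isHermitian.eigenvalues i ^ 2 / M - hA.isHermitian.eigenvalues i := by ring
          linarith
    _ = (∑ i, hA.isHermitian.eigenvalues i ^ 2) / M - 1 + Real.log M := by
        rw [Finset.sum_add_distrib, Finset.sum_sub_distrib, ← Finset.sum_div, ← Finset.sum_mul,
          hsum, one_mul]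
    _ ≤ _ := by
        have := (div_le_one hM0).2 hM
        linarith

theorem ruChannel_posSemidef {n d : ℕ} {w : Fin d → ℝ} (hw : ∀ i, 0 ≤ w i)
    (U : Fin d → Matrix (Fin n) (Fin n) ℂ) {ρ : Matrix (Fin n) (Fin n) ℂ} (hρ : ρ.PosSemidef) :
    (ruChannel w U ρ).PosSemidef := by
  refine Matrix.posSemidef_sum _ fun i _ => ?_
  exact (hρ.mul_mul_conjTranspose_same (U i)).smul (by exact_mod_cast hw i)

theorem trace_ruChannel {n d : ℕ} {w : Fin d → ℝ} (hw : ∑ i, w i = 1)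
    {U : Fin d → Matrix (Fin n) (Fin n) ℂ} (hU : ∀ i, U i ∈ Matrix.unitaryGroup (Fin n) ℂ)
    (ρ : Matrix (Fin n) (Fin n) ℂ) : (ruChannel w U ρ).trace = ρ.trace := by
  have h : ∀ i, ((w i : ℂ) • (U i * ρ * (U i)ᴴ)).trace = (w i : ℂ) * ρ.trace := by
    intro i
    rw [trace_smul, trace_mul_cycle, ← Matrix.star_eq_conjTranspose,
      Matrix.mem_unitaryGroup_iff'.1 (hU i), one_mul, smul_eq_mul]
  rw [ruChannel, trace_sum, Finset.sum_congr rfl fun i _ => h i, ← Finset.sum_mul,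
    ← Complex.ofReal_sum, hw, Complex.ofReal_one, one_mul]

theorem ruChannel_sum_smul {n d : ℕ} (w : Fin d → ℝ) (U : Fin d → Matrix (Fin n) (Fin n) ℂ)
    {ι : Type*} (s : Finset ι) (c : ι → ℂ) (ρ : ι → Matrix (Fin n) (Fin n) ℂ) :
    ruChannel w U (∑ k ∈ s, c k • ρ k) = ∑ k ∈ s, c k • ruChannel w U (ρ k) := by
  simp only [ruChannel, Finset.smul_sum, Finset.mul_sum, Finset.sum_mul]
  rw [Finset.sum_comm]
  refine Finset.sum_congr rfl fun k _ => Finset.sum_congr rfl fun i _ => ?_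
  rw [Matrix.mul_smul, Matrix.smul_mul, smul_comm]

/-- The Frobenius norm of the image of a mixed state is at most its maximum over pure states. -/
theorem norm_ruChannel_le {n d : ℕ} (w : Fin d → ℝ) (U : Fin d → Matrix (Fin n) (Fin n) ℂ) {C : ℝ}
    (hC : ∀ v : EuclideanSpace ℂ (Fin n), ‖v‖ = 1 →
      ‖ruChannel w U (vecMulVec v.ofLp (star v.ofLp))‖ ≤ C)
    {ρ : Matrix (Fin n) (Fin n) ℂ} (hρ : ρ.PosSemidef) (htr : ρ.trace = 1) :
    ‖ruChannel w U ρ‖ ≤ C := by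
  have hsum : ∑ i, hρ.isHermitian.eigenvalues i = 1 :=
    sum_eigenvalues_eq_one hρ.isHermitian htr
  rw [eq_sum_eigenvalues_smul_vecMulVec hρ.isHermitian, ruChannel_sum_smul]
  calc _ ≤ ∑ k, hρ.isHermitian.eigenvalues k * C := by
        refine (norm_sum_le _ _).trans (Finset.sum_le_sum fun k _ => ?_)
        rw [norm_smul, Complex.norm_real, Real.norm_of_nonneg (hρ.eigenvalues_nonneg k)]
        exact mul_le_mul_of_nonneg_left (hC _ (hρ.isHermitian.eigenvectorBasis.orthonormal.1 k))
          (hρ.eigenvalues_nonneg k)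
    _ = C := by rw [← Finset.sum_mul, hsum, one_mul]

/-- For uniform weights the purity of the image of a pure state is read off the Gram matrix. -/
theorem norm_sq_ruChannel_vecMulVec {n d : ℕ} (hd : d ≠ 0)
    (U : Fin d → unitary (EuclideanSpace ℂ (Fin n) →L[ℂ] EuclideanSpace ℂ (Fin n)))
    {v : EuclideanSpace ℂ (Fin n)} (hv : ‖v‖ = 1) :
    ‖ruChannel (fun _ => (d : ℝ)⁻¹) (fun i => (toEuclideanCLM (n := Fin n) (𝕜 := ℂ)).symm (U i))
        (vecMulVec v.ofLp (star v.ofLp))‖ ^ 2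
      = (d + ‖offGramVec fun p =>
          (U p : EuclideanSpace ℂ (Fin n) →L[ℂ] EuclideanSpace ℂ (Fin n)) v‖ ^ 2) / d ^ 2 := by
  set f : Fin d → EuclideanSpace ℂ (Fin n) := fun p =>
    (U p : EuclideanSpace ℂ (Fin n) →L[ℂ] EuclideanSpace ℂ (Fin n)) v with hf
  have hfn : ∀ p, ‖f p‖ = 1 := fun p => by rw [hf, ← hv]; exact norm_unitary_clm_apply (U p) v
  have hU : ∀ i, (toEuclideanCLM (n := Fin n) (𝕜 := ℂ)).symm (U i) *ᵥ v.ofLp = (f i).ofLp := by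
    intro i
    rw [← ofLp_toEuclideanCLM, StarAlgEquiv.apply_symm_apply]
  have hch : ruChannel (fun _ => (d : ℝ)⁻¹)
      (fun i => (toEuclideanCLM (n := Fin n) (𝕜 := ℂ)).symm (U i))
      (vecMulVec v.ofLp (star v.ofLp))
      = ((d : ℝ)⁻¹ : ℂ) • ∑ i, vecMulVec (f i).ofLp (star (f i).ofLp) := by
    rw [ruChannel, Finset.smul_sum]
    refine Finset.sum_congr rfl fun i _ => ?_
    rw [mul_vecMulVec, vecMulVec_mul, ← Matrix.star_mulVec, hU]
    simp
  have htr : ∀ i j, ((vecMulVec (f i).ofLp (star (f i).ofLp))ᴴ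
      * vecMulVec (f j).ofLp (star (f j).ofLp)).trace.re = ‖inner ℂ (f i) (f j)‖ ^ 2 := by
    intro i j
    rw [conjTranspose_vecMulVec, star_star, vecMulVec_mul_vecMulVec, trace_vecMulVec,
      dotProduct_smul, smul_eq_mul, ← Complex.normSq_eq_norm_sq, ← Complex.ofReal_re
        (Complex.normSq _), ← Complex.mul_conj, inner_conj_symm,
      EuclideanSpace.inner_eq_star_dotProduct, EuclideanSpace.inner_eq_star_dotProduct,
      dotProduct_comm (star (f i).ofLp)]
  have hgram : ∑ i, ∑ j, ‖inner ℂ (f i) (f j)‖ ^ 2 = d + ‖offGramVec f‖ ^ 2 := by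
    have h1 : (d : ℝ) = ∑ i : Fin d, ∑ j : Fin d, if i = j then 1 else 0 := by simp
    rw [EuclideanSpace.norm_sq_eq, Fintype.sum_prod_type]
    conv_rhs => rw [h1]
    simp only [← Finset.sum_add_distrib]
    refine Finset.sum_congr rfl fun i _ => Finset.sum_congr rfl fun j _ => ?_
    by_cases h : i = j
    · subst h
      rw [inner_self_eq_norm_sq_to_K, hfn]
      simp [offGramVec]
    · rw [norm_inner_symm]
      simp [offGramVec, h]
  rw [hch, norm_smul, mul_pow, frobenius_norm_sq, conjTranspose_sum, Finset.sum_mul]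
  simp only [Finset.mul_sum, trace_sum, Complex.re_sum, htr, hgram]
  have hd' : (d : ℝ) ≠ 0 := Nat.cast_ne_zero.2 hd
  rw [norm_inv, Complex.norm_real, Real.norm_natCast]
  field_simp

/-- A bound on the off-diagonal Gram entries bounds all output entropies from below. -/
theorem log_sub_div_le_vnEntropy_ruChannel {n d : ℕ} (hd : d ≠ 0)
    {U : Fin d → unitary (EuclideanSpace ℂ (Fin n) →L[ℂ] EuclideanSpace ℂ (Fin n))} {C : ℝ}
    (hU : ∀ v : EuclideanSpace ℂ (Fin n), ‖v‖ = 1 → ‖offGramVec fun p =>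
      (U p : EuclideanSpace ℂ (Fin n) →L[ℂ] EuclideanSpace ℂ (Fin n)) v‖ ≤ C)
    {ρ : Matrix (Fin n) (Fin n) ℂ} (hρ : ρ.PosSemidef) (htr : ρ.trace = 1) :
    Real.log d - C ^ 2 / d ≤ vnEntropy (ruChannel (fun _ => (d : ℝ)⁻¹)
      (fun i => (toEuclideanCLM (n := Fin n) (𝕜 := ℂ)).symm (U i)) ρ) := by
  have hdpos : (0 : ℝ) < d := by positivity
  have hw : ∑ _i : Fin d, (d : ℝ)⁻¹ = 1 := by simp [hd]
  have hM : 0 < (d + C ^ 2) / (d : ℝ) ^ 2 := by positivity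
  have hnorm := norm_ruChannel_le (C := √((d + C ^ 2) / (d : ℝ) ^ 2)) (fun _ => (d : ℝ)⁻¹)
    (fun i => (toEuclideanCLM (n := Fin n) (𝕜 := ℂ)).symm (U i)) (fun v hv => by
      refine Real.le_sqrt_of_sq_le ?_
      rw [norm_sq_ruChannel_vecMulVec hd U hv]
      have := hU v hv
      gcongr) hρ htr
  have hent := neg_log_le_vnEntropy
    (ruChannel_posSemidef (fun _ => by positivity)
      (fun i => (toEuclideanCLM (n := Fin n) (𝕜 := ℂ)).symm (U i)) hρ)
    ((trace_ruChannel hw (fun i => Unitary.map_mem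
      (toEuclideanCLM (n := Fin n) (𝕜 := ℂ)).symm (U i).2) ρ).trans htr) hM
    ((Real.le_sqrt (norm_nonneg _) hM.le).1 hnorm)
  refine le_trans ?_ hent
  have hsplit : (d + C ^ 2) / (d : ℝ) ^ 2 = (1 + C ^ 2 / d) / d := by field_simp
  have hpos : 0 < 1 + C ^ 2 / (d : ℝ) := by positivity
  rw [hsplit, Real.log_div hpos.ne' hdpos.ne']
  linarith [Real.log_le_sub_one_of_pos hpos]

end Entropy

/-- Hastings' theorem: there is `h_min` such that for every `h > h_min` and every `d ≥ 2`
with `d log d ≥ h`, for all sufficiently large `n` there is a random unitary channel `Φ`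
with `S_min(Φ) > log d − h/d`. -/
theorem exists_channel_large_minOutEntropy :
    ∃ hmin : ℝ, ∀ h : ℝ, hmin < h → ∀ d : ℕ, 2 ≤ d → h ≤ (d : ℝ) * Real.log d →
      ∃ N : ℕ, ∀ n : ℕ, N ≤ n →
        ∃ (w : Fin d → ℝ) (U : Fin d → Matrix (Fin n) (Fin n) ℂ),
          (∀ i, 0 ≤ w i) ∧ ∑ i, w i = 1 ∧
          (∀ i, U i ∈ Matrix.unitaryGroup (Fin n) ℂ) ∧
          Real.log d - h / d < minOutEntropy (ruChannel w U) := by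
  refine ⟨112 ^ 2, fun h hh d hd _ => ?_⟩
  obtain ⟨N, hN1, hN⟩ := exists_unitaries_norm_offGramVec_le d
  refine ⟨N, fun n hn => ?_⟩
  obtain ⟨U, hU⟩ := hN n hn
  have hd0 : d ≠ 0 := by omega
  have hdpos : (0 : ℝ) < d := by positivity
  have hn0 : n ≠ 0 := by omega
  refine ⟨fun _ => (d : ℝ)⁻¹, fun i => (toEuclideanCLM (n := Fin n) (𝕜 := ℂ)).symm (U i),
    fun _ => by positivity, by simp [hd0],
    fun i => Unitary.map_mem (toEuclideanCLM (n := Fin n) (𝕜 := ℂ)).symm (U i).2, ?_⟩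
  have hlt : Real.log d - h / d < Real.log d - 112 ^ 2 / d := by gcongr
  refine hlt.trans_le (le_csInf ?_ ?_)
  · let i₀ : Fin n := ⟨0, Nat.pos_of_ne_zero hn0⟩
    refine ⟨_, diagonal (Pi.single i₀ 1), ?_, ?_, rfl⟩
    · exact Matrix.PosSemidef.diagonal (Pi.single_nonneg.2 zero_le_one)
    · simp [trace_diagonal]
  · rintro _ ⟨ρ, hρ, htr, rfl⟩
    exact log_sub_div_le_vnEntropy_ruChannel hd0 hU hρ htr
end
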